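/- arXiv:math/9908111 — 2 statements merged into one kernel-verified Lean document; each statement's English description precedes it below -/
import Mathlib

section
/- Let (Ω₁,μ) and (Ω₂,ν) be σ-finite measure spaces, let E and F be real Banach spaces, and let 1 ≤ p < r < q < ∞. Let T : L^q(μ;E) → L^p(ν;F) be a map between the Bochner spaces satisfying T(cx) = c·T(x) for all c ≥ 0, and assume that for every n and all x₁,…,xₙ ∈ L^q(μ;E), (∫ (∑_{k≤n} ‖(Tx_k)(ω₂)‖_F^r)^{p/r} dν(ω₂))^{1/p} ≤ (∫ (∑_{k≤n} ‖x_k(ω₁)‖_E^r)^{q/r} dμ(ω₁))^{1/q}. Then there exist measurable weights ω₁ : Ω₁ → [0,∞) with ‖ω₁‖_{L^{q/(q-r)}(μ)} ≤ 1 and ω₂ : Ω₂ → [0,∞) with ‖ω₂‖_{L^{p/(r-p)}(ν)} ≤ 1 such that for every x ∈ L^q(μ;E), ∫ ‖(Tx)(·)‖_F^r / ω₂ dν ≤ ∫ ‖x(·)‖_E^r ω₁ dμ. -/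
open MeasureTheory ENNReal
open scoped NNReal ENNReal
open Filter Topology

/-- Bernoulli's inequality for exponents in `(0, 1)`, with a quadratic remainder. -/
lemma rpow_add_sq_le {t a : ℝ} (ht0 : 0 < t) (ht1 : t < 1) (ha : 0 ≤ a) :
    a ^ t + (1 - t) * (a ^ (t / 2) - 1) ^ 2 ≤ 1 + t * (a - 1) := by
  set z := a ^ (t / 2) with hz
  have hz0 : 0 ≤ z := by positivity
  have h1 : a ^ t = z ^ 2 := by
    rw [hz, ← Real.rpow_natCast, ← Real.rpow_mul ha]; congr 1; push_cast; ring
  have key := Real.geom_mean_le_arith_mean2_weighted (w₁ := (2 - 2 * t) / (2 - t))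
    (w₂ := t / (2 - t)) (p₁ := z) (p₂ := a) (div_nonneg (by linarith) (by linarith))
    (div_nonneg (by linarith) (by linarith)) hz0 ha (by field_simp [show 2 - t ≠ 0 by linarith]; ring)
  have h2 : z ^ ((2 - 2 * t) / (2 - t)) * a ^ (t / (2 - t)) = z ^ 2 := by
    rw [← h1, hz, ← Real.rpow_mul ha, ← Real.rpow_add' ha]
    · congr 1; field_simp [show 2 - t ≠ 0 by linarith]; ring
    · have : 0 < 2 - t := by linarith
      have : t / 2 * ((2 - 2 * t) / (2 - t)) + t / (2 - t) = t := by field_simp; ring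
      rw [this]; exact ht0.ne'
  rw [h2] at key
  have h3 : (2 - t) * z ^ 2 ≤ (2 - 2 * t) * z + t * a := by
    have : 0 < 2 - t := by linarith
    calc (2 - t) * z ^ 2 ≤ (2 - t) * ((2 - 2 * t) / (2 - t) * z + t / (2 - t) * a) := by gcongr
      _ = _ := by field_simp
  rw [h1]; nlinarith

/-- Bernoulli's inequality for exponents larger than `1`, with a quadratic remainder. -/
lemma add_sq_le_rpow {s a : ℝ} (hs : 1 < s) (ha : 0 ≤ a) :
    1 + s * (a - 1) + min (s - 1) 1 * (a ^ (s / 2) - 1) ^ 2 ≤ a ^ s := by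
  set z := a ^ (s / 2) with hz
  have hz0 : 0 ≤ z := by positivity
  have h1 : a ^ s = z ^ 2 := by
    rw [hz, ← Real.rpow_natCast, ← Real.rpow_mul ha]; congr 1; push_cast; ring
  rw [h1]
  rcases le_or_gt 2 s with h | h
  · rw [min_eq_right (by linarith)]
    have := one_add_mul_self_le_rpow_one_add (s := a - 1) (by linarith) (p := s / 2) (by linarith)
    rw [show 1 + (a - 1) = a by ring, ← hz] at this
    nlinarith
  · rw [min_eq_left (by linarith)]
    have key := Real.geom_mean_le_arith_mean2_weighted (w₁ := (2 * s - 2) / s)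
      (w₂ := (2 - s) / s) (p₁ := z) (p₂ := z ^ 2) (div_nonneg (by linarith) (by linarith))
      (div_nonneg (by linarith) (by linarith)) hz0 (by positivity) (by field_simp; ring)
    have h2 : z ^ ((2 * s - 2) / s) * (z ^ 2) ^ ((2 - s) / s) = a := by
      rw [← h1, hz, ← Real.rpow_mul ha, ← Real.rpow_mul ha, ← Real.rpow_add' ha]
      · rw [show s / 2 * ((2 * s - 2) / s) + s * ((2 - s) / s) = 1 by field_simp; ring,
          Real.rpow_one]
      · rw [show s / 2 * ((2 * s - 2) / s) + s * ((2 - s) / s) = 1 by field_simp; ring]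
        exact one_ne_zero
    rw [h2] at key
    have h3 : s * a ≤ (2 * s - 2) * z + (2 - s) * z ^ 2 := by
      calc s * a ≤ s * ((2 * s - 2) / s * z + (2 - s) / s * z ^ 2) := by gcongr
        _ = _ := by field_simp
    nlinarith

/-- A uniform form of the strict concavity of `x ↦ x ^ t` for `0 < t < 1`. -/
lemma add_rpow_div_two_add_sq_le {t a b : ℝ} (ht0 : 0 < t) (ht1 : t < 1) (ha : 0 ≤ a)
    (hb : 0 ≤ b) :
    (a ^ t + b ^ t) / 2 + (1 - t) / 4 * (a ^ (t / 2) - b ^ (t / 2)) ^ 2 ≤ ((a + b) / 2) ^ t := by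
  rcases (add_nonneg ha hb).eq_or_lt' with h | h
  · obtain rfl : a = 0 := by linarith
    obtain rfl : b = 0 := by linarith
    simp [ht0.ne']
  obtain ⟨m, hm⟩ : ∃ m, m = (a + b) / 2 := ⟨_, rfl⟩
  have hm0 : 0 < m := by rw [hm]; linarith
  obtain ⟨x, rfl⟩ : ∃ x, a = m * x := ⟨a / m, by field_simp⟩
  obtain ⟨y, rfl⟩ : ∃ y, b = m * y := ⟨b / m, by field_simp⟩
  have hx : 0 ≤ x := nonneg_of_mul_nonneg_right ha hm0
  have hy : 0 ≤ y := nonneg_of_mul_nonneg_right hb hm0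
  have hxy : x + y = 2 := by
    have : m * (x + y - 2) = 0 := by linarith
    rcases mul_eq_zero.1 this with h | h <;> linarith
  rw [← hm]
  simp only [Real.mul_rpow hm0.le hx, Real.mul_rpow hm0.le hy]
  have hmt : m ^ t = (m ^ (t / 2)) ^ 2 := by
    rw [← Real.rpow_natCast, ← Real.rpow_mul hm0.le]; congr 1; push_cast; ring
  have h1 := rpow_add_sq_le ht0 ht1 hx
  have h2 := rpow_add_sq_le ht0 ht1 hy
  have h3 : (x ^ t + y ^ t) / 2 + (1 - t) / 4 * (x ^ (t / 2) - y ^ (t / 2)) ^ 2 ≤ 1 := by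
    nlinarith [mul_nonneg (sub_nonneg.2 ht1.le) (sq_nonneg (x ^ (t / 2) + y ^ (t / 2) - 2))]
  calc _ = m ^ t * ((x ^ t + y ^ t) / 2 + (1 - t) / 4 * (x ^ (t / 2) - y ^ (t / 2)) ^ 2) := by
        rw [hmt]; ring
    _ ≤ m ^ t * 1 := by gcongr
    _ = _ := mul_one _

/-- A uniform form of the strict convexity of `x ↦ x ^ s` for `1 < s`. -/
lemma rpow_div_two_add_sq_le {s a b : ℝ} (hs : 1 < s) (ha : 0 ≤ a) (hb : 0 ≤ b) :
    ((a + b) / 2) ^ s + min (s - 1) 1 / 4 * (a ^ (s / 2) - b ^ (s / 2)) ^ 2 ≤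
      (a ^ s + b ^ s) / 2 := by
  rcases (add_nonneg ha hb).eq_or_lt' with h | h
  · obtain rfl : a = 0 := by linarith
    obtain rfl : b = 0 := by linarith
    simp [show s ≠ 0 by linarith]
  obtain ⟨m, hm⟩ : ∃ m, m = (a + b) / 2 := ⟨_, rfl⟩
  have hm0 : 0 < m := by rw [hm]; linarith
  obtain ⟨x, rfl⟩ : ∃ x, a = m * x := ⟨a / m, by field_simp⟩
  obtain ⟨y, rfl⟩ : ∃ y, b = m * y := ⟨b / m, by field_simp⟩
  have hx : 0 ≤ x := nonneg_of_mul_nonneg_right ha hm0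
  have hy : 0 ≤ y := nonneg_of_mul_nonneg_right hb hm0
  have hxy : x + y = 2 := by
    have : m * (x + y - 2) = 0 := by linarith
    rcases mul_eq_zero.1 this with h | h <;> linarith
  rw [← hm]
  simp only [Real.mul_rpow hm0.le hx, Real.mul_rpow hm0.le hy]
  have hms : m ^ s = (m ^ (s / 2)) ^ 2 := by
    rw [← Real.rpow_natCast, ← Real.rpow_mul hm0.le]; congr 1; push_cast; ring
  have h1 := add_sq_le_rpow hs hx
  have h2 := add_sq_le_rpow hs hy
  have hc : 0 ≤ min (s - 1) 1 := le_min (by linarith) zero_le_one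
  have h3 : 1 + min (s - 1) 1 / 4 * (x ^ (s / 2) - y ^ (s / 2)) ^ 2 ≤ (x ^ s + y ^ s) / 2 := by
    nlinarith [mul_nonneg hc (sq_nonneg (x ^ (s / 2) + y ^ (s / 2) - 2))]
  calc _ = m ^ s * (1 + min (s - 1) 1 / 4 * (x ^ (s / 2) - y ^ (s / 2)) ^ 2) := by
        rw [hms]; ring
    _ ≤ m ^ s * ((x ^ s + y ^ s) / 2) := by gcongr
    _ = _ := by ring

/-- The increment of `x ↦ x ^ t`, `0 < t < 1`, is at least its derivative at the right end. -/
lemma mul_rpow_sub_one_le_rpow_sub_rpow {t a b : ℝ} (ht0 : 0 < t) (ht1 : t < 1) (ha : 0 ≤ a)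
    (hab : a < b) : t * ((b - a) * b ^ (t - 1)) ≤ b ^ t - a ^ t := by
  have hb : 0 < b := ha.trans_lt hab
  have h := rpow_add_sq_le ht0 ht1 (div_nonneg ha hb.le)
  have h' : (a / b) ^ t ≤ 1 + t * (a / b - 1) := by
    nlinarith [mul_nonneg (sub_nonneg.2 ht1.le) (sq_nonneg ((a / b) ^ (t / 2) - 1))]
  rw [Real.div_rpow ha hb.le, div_le_iff₀ (by positivity)] at h'
  rw [Real.rpow_sub_one hb.ne']
  have : (1 + t * (a / b - 1)) * b ^ t = b ^ t - t * ((b - a) * (b ^ t / b)) := by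
    field_simp; ring
  linarith

/-- The increment of `x ↦ x ^ s`, `1 < s`, is at most its derivative at the right end. -/
lemma rpow_sub_rpow_le_mul_rpow_sub_one {s a b : ℝ} (hs : 1 < s) (ha : 0 ≤ a) (hab : a ≤ b) :
    b ^ s - a ^ s ≤ s * ((b - a) * b ^ (s - 1)) := by
  rcases (ha.trans hab).eq_or_lt' with hb | hb
  · obtain rfl : a = 0 := by linarith
    simp [hb]
  have h := add_sq_le_rpow hs (div_nonneg ha hb.le)
  have hc : 0 ≤ min (s - 1) 1 := le_min (by linarith) zero_le_one
  have h' : 1 + s * (a / b - 1) ≤ (a / b) ^ s := by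
    nlinarith [mul_nonneg hc (sq_nonneg ((a / b) ^ (s / 2) - 1))]
  rw [Real.div_rpow ha hb.le, le_div_iff₀ (by positivity)] at h'
  rw [Real.rpow_sub_one hb.ne']
  have : (1 + s * (a / b - 1)) * b ^ s = b ^ s - s * ((b - a) * (b ^ s / b)) := by
    field_simp; ring
  linarith

/-- The function `y ↦ y ^ t / t - y ^ s / s` is maximal at `1`. -/
lemma rpow_div_sub_rpow_div_le {s t y : ℝ} (ht0 : 0 < t) (ht1 : t < 1) (hs : 1 < s)
    (hy : 0 ≤ y) : y ^ t / t - y ^ s / s ≤ 1 / t - 1 / s := by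
  have h1 : y ^ t ≤ 1 + t * (y - 1) := by
    nlinarith [rpow_add_sq_le ht0 ht1 hy,
      mul_nonneg (sub_nonneg.2 ht1.le) (sq_nonneg (y ^ (t / 2) - 1))]
  have hc : 0 ≤ min (s - 1) 1 := le_min (by linarith) zero_le_one
  have h2 : 1 + s * (y - 1) ≤ y ^ s := by
    nlinarith [add_sq_le_rpow hs hy, mul_nonneg hc (sq_nonneg (y ^ (s / 2) - 1))]
  have hs0 : 0 < s := by linarith
  have h3 : y ^ t / t ≤ 1 / t + (y - 1) := by
    rw [div_le_iff₀ ht0]; field_simp; linarith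
  have h4 : 1 / s + (y - 1) ≤ y ^ s / s := by
    rw [le_div_iff₀ hs0]; field_simp; linarith
  linarith

/-- Nonnegative functions `f n` with `(f n) ^ e` Cauchy in `L²` at a geometric rate converge
almost everywhere. -/
lemma exists_ae_tendsto_of_integral_rpow_sub_sq_le {Ω : Type*} [MeasurableSpace Ω]
    {μ : Measure Ω} {f : ℕ → Ω → ℝ} {e C : ℝ} (he : 0 < e) (hC : 0 ≤ C)
    (hf : ∀ n, Measurable (f n)) (hf0 : ∀ n x, 0 ≤ f n x)
    (hint : ∀ n m, Integrable (fun x => (f n x ^ e - f m x ^ e) ^ 2) μ)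
    (hle : ∀ n m, ∫ x, (f n x ^ e - f m x ^ e) ^ 2 ∂μ ≤ C * ((1 / 4) ^ n + (1 / 4) ^ m)) :
    ∃ g : Ω → ℝ, Measurable g ∧ (∀ x, 0 ≤ g x) ∧
      ∀ᵐ x ∂μ, Tendsto (fun n => f n x) atTop (𝓝 (g x)) := by
  have hmeas : ∀ n, Measurable (fun x => f n x ^ e) := fun n => (hf n).pow_const e
  have hcauchy : ∀ᵐ x ∂μ, ∃ l, Tendsto (fun n => f n x ^ e) atTop (𝓝 l) := by
    refine Lp.ae_tendsto_of_cauchy_eLpNorm (p := 2)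
      (B := fun N => ENNReal.ofReal ((√(2 * C) + 1) * (1 / 2) ^ N))
      (fun n => (hmeas n).aestronglyMeasurable) (by norm_num) ?_ ?_
    · exact ((summable_geometric_of_lt_one (by norm_num) (by norm_num)).mul_left _).tsum_ofReal_ne_top
    · intro N n m hn hm
      have hmem : MemLp ((fun x => f n x ^ e) - fun x => f m x ^ e) 2 μ :=
        (memLp_two_iff_integrable_sq
          ((hmeas n).sub (hmeas m)).aestronglyMeasurable).2 (hint n m)
      rw [hmem.eLpNorm_eq_integral_rpow_norm (by norm_num) (by norm_num)]
      rw [ENNReal.ofReal_lt_ofReal_iff (by positivity)]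
      have h1 : ∫ x, ‖((fun x => f n x ^ e) - fun x => f m x ^ e) x‖ ^ (2 : ℝ≥0∞).toReal ∂μ
          ≤ 2 * C * ((1 / 2) ^ N) ^ 2 := by
        have : ∀ k, N ≤ k → ((1 : ℝ) / 4) ^ k ≤ ((1 / 2) ^ N) ^ 2 := fun k hk => by
          rw [← pow_mul, mul_comm, pow_mul]
          norm_num only
          exact pow_le_pow_of_le_one (by norm_num) (by norm_num) hk
        calc _ = ∫ x, (f n x ^ e - f m x ^ e) ^ 2 ∂μ := by
              congr 1; ext x
              simp
          _ ≤ C * ((1 / 4) ^ n + (1 / 4) ^ m) := hle n m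
          _ ≤ C * (((1 / 2) ^ N) ^ 2 + ((1 / 2) ^ N) ^ 2) := by
              gcongr <;> apply this <;> assumption
          _ = _ := by ring
      calc _ ≤ (2 * C * ((1 / 2) ^ N) ^ 2) ^ ((2 : ℝ≥0∞).toReal)⁻¹ :=
            Real.rpow_le_rpow (by positivity) h1 (by positivity)
        _ = √(2 * C) * (1 / 2) ^ N := by
            rw [show ((2 : ℝ≥0∞).toReal)⁻¹ = 1 / 2 by norm_num, ← Real.sqrt_eq_rpow,
              Real.sqrt_mul (by positivity), Real.sqrt_sq (by positivity)]
        _ < _ := by gcongr; linarith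
  have hconv : ∀ᵐ x ∂μ, ∃ l, Tendsto (fun n => f n x) atTop (𝓝 l) := by
    filter_upwards [hcauchy] with x ⟨l, hl⟩
    refine ⟨l ^ e⁻¹, (hl.rpow_const (Or.inr (by positivity))).congr fun n => ?_⟩
    rw [← Real.rpow_mul (hf0 n x), mul_inv_cancel₀ he.ne', Real.rpow_one]
  obtain ⟨g, hg, hlim⟩ :=
    measurable_limit_of_tendsto_metrizable_ae (fun n => (hf n).aemeasurable) hconv
  refine ⟨fun x => |g x|, hg.abs, fun x => abs_nonneg _, ?_⟩
  filter_upwards [hlim] with x hx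
  exact hx.abs.congr fun n => abs_of_nonneg (hf0 n x)

/-- If `h n → h₀` almost everywhere with `h n` bounded in `L^s`, then `∫ f (h n) ^ (s - 1)` is
asymptotically at most `∫ f h₀ ^ (s - 1)` for every `f` in `L^s`. -/
lemma liminf_lintegral_mul_rpow_sub_one_le {Ω : Type*} [MeasurableSpace Ω]
    {μ : Measure Ω} {f h₀ : Ω → ℝ} {h : ℕ → Ω → ℝ} {s C : ℝ} {ε : ℕ → ℝ≥0∞} (hs : 1 < s)
    (hf : Measurable f) (hf0 : ∀ x, 0 ≤ f x) (hfint : Integrable (fun x => f x ^ s) μ)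
    (hh : ∀ n, Measurable (h n)) (hh0 : ∀ n x, 0 ≤ h n x)
    (hC : ∀ n, ∫⁻ x, ENNReal.ofReal (h n x ^ s) ∂μ ≤ ENNReal.ofReal C)
    (hlim : ∀ᵐ x ∂μ, Tendsto (fun n => h n x) atTop (𝓝 (h₀ x)))
    (hε : Tendsto ε atTop (𝓝 0)) :
    liminf (fun n => ∫⁻ x, ENNReal.ofReal (f x * h n x ^ (s - 1)) ∂μ + ε n) atTop ≤
      ∫⁻ x, ENNReal.ofReal (f x * h₀ x ^ (s - 1)) ∂μ := by
  have hs1 : 0 < s - 1 := by linarith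
  have hh₀ : ∀ᵐ x ∂μ, 0 ≤ h₀ x := by
    filter_upwards [hlim] with x hx
    exact ge_of_tendsto' hx fun n => hh0 n x
  have hpow : ∀ y : ℝ, 0 ≤ y → y * y ^ (s - 1) = y ^ s := fun y hy => by
    conv_lhs => rw [← Real.rpow_one_add' hy (by linarith)]
    congr 1; ring
  have htrunc : ∀ K : ℕ, liminf (fun n => ∫⁻ x, ENNReal.ofReal (f x * h n x ^ (s - 1)) ∂μ + ε n)
      atTop ≤ ∫⁻ x, ENNReal.ofReal (f x * h₀ x ^ (s - 1)) ∂μ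
        + ENNReal.ofReal (C * (1 / ((K : ℝ) + 1))) := by
    intro K
    set k : ℝ := (K : ℝ) + 1
    have hk : 0 < k := by positivity
    have hmeas : ∀ n, Measurable
        (fun x => ENNReal.ofReal (f x * min (h n x) (k * f x) ^ (s - 1))) := fun n =>
      (hf.mul (((hh n).min (hf.const_mul k)).pow_const _)).ennreal_ofReal
    have hbound : ∀ n, ∫⁻ x, ENNReal.ofReal (f x * h n x ^ (s - 1)) ∂μ + ε n ≤
        ∫⁻ x, ENNReal.ofReal (f x * min (h n x) (k * f x) ^ (s - 1)) ∂μ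
          + ENNReal.ofReal (C * (1 / k)) + ε n := by
      intro n
      gcongr
      calc _ ≤ ∫⁻ x, ENNReal.ofReal (f x * min (h n x) (k * f x) ^ (s - 1))
            + ENNReal.ofReal (h n x ^ s) * ENNReal.ofReal (1 / k) ∂μ := by
            refine lintegral_mono fun x => ?_
            rw [← ENNReal.ofReal_mul (Real.rpow_nonneg (hh0 n x) _), ← ENNReal.ofReal_add
              (mul_nonneg (hf0 x) (Real.rpow_nonneg (le_min (hh0 n x)
                (mul_nonneg hk.le (hf0 x))) _))
              (mul_nonneg (Real.rpow_nonneg (hh0 n x) _) (by positivity))]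
            apply ENNReal.ofReal_le_ofReal
            rcases le_total (h n x) (k * f x) with hle | hle
            · rw [min_eq_left hle]
              have : 0 ≤ h n x ^ s * (1 / k) :=
                mul_nonneg (Real.rpow_nonneg (hh0 n x) _) (by positivity)
              linarith
            · have h1 : f x ≤ h n x * (1 / k) := by
                rw [mul_one_div, le_div_iff₀ hk]; linarith
              have h2 : 0 ≤ f x * min (h n x) (k * f x) ^ (s - 1) :=
                mul_nonneg (hf0 x) (Real.rpow_nonneg (le_min (hh0 n x)
                  (mul_nonneg hk.le (hf0 x))) _)
              calc f x * h n x ^ (s - 1) ≤ h n x * (1 / k) * h n x ^ (s - 1) :=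
                    mul_le_mul_of_nonneg_right h1 (Real.rpow_nonneg (hh0 n x) _)
                _ = h n x ^ s * (1 / k) := by rw [← hpow _ (hh0 n x)]; ring
                _ ≤ _ := by linarith
        _ = ∫⁻ x, ENNReal.ofReal (f x * min (h n x) (k * f x) ^ (s - 1)) ∂μ
            + (∫⁻ x, ENNReal.ofReal (h n x ^ s) ∂μ) * ENNReal.ofReal (1 / k) := by
            rw [lintegral_add_left (hmeas n), lintegral_mul_const _
              ((hh n).pow_const _).ennreal_ofReal]
        _ ≤ _ := by
            rw [ENNReal.ofReal_mul' (by positivity)]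
            gcongr
            exact hC n
    have hdom : Tendsto (fun n => ∫⁻ x, ENNReal.ofReal
        (f x * min (h n x) (k * f x) ^ (s - 1)) ∂μ) atTop
        (𝓝 (∫⁻ x, ENNReal.ofReal (f x * min (h₀ x) (k * f x) ^ (s - 1)) ∂μ)) := by
      refine tendsto_lintegral_of_dominated_convergence
        (fun x => ENNReal.ofReal (k ^ (s - 1) * f x ^ s)) hmeas (fun n => ae_of_all _ fun x => ?_)
        ?_ ?_
      · apply ENNReal.ofReal_le_ofReal
        calc _ ≤ f x * (k * f x) ^ (s - 1) := by
              refine mul_le_mul_of_nonneg_left (Real.rpow_le_rpow (le_min (hh0 n x)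
                (mul_nonneg hk.le (hf0 x))) (min_le_right _ _) hs1.le) (hf0 x)
          _ = k ^ (s - 1) * f x ^ s := by
              rw [Real.mul_rpow hk.le (hf0 x), ← hpow _ (hf0 x)]; ring
      · exact (hfint.const_mul _).lintegral_lt_top.ne
      · filter_upwards [hlim] with x hx
        refine (ENNReal.continuous_ofReal.tendsto _).comp (Tendsto.const_mul _ ?_)
        exact (hx.min tendsto_const_nhds).rpow_const (Or.inr hs1.le)
    have htotal := (hdom.add_const (ENNReal.ofReal (C * (1 / k)))).add hε
    calc _ ≤ liminf (fun n => ∫⁻ x, ENNReal.ofReal (f x * min (h n x) (k * f x) ^ (s - 1)) ∂μ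
          + ENNReal.ofReal (C * (1 / k)) + ε n) atTop :=
          liminf_le_liminf (Eventually.of_forall hbound)
      _ = _ := htotal.liminf_eq
      _ ≤ _ := by
          rw [add_zero]
          gcongr ?_ + _
          refine lintegral_mono_ae ?_
          filter_upwards [hh₀] with x hx
          apply ENNReal.ofReal_le_ofReal
          refine mul_le_mul_of_nonneg_left (Real.rpow_le_rpow (le_min hx
                (mul_nonneg hk.le (hf0 x))) (min_le_left _ _) hs1.le) (hf0 x)
  have hK : Tendsto (fun K : ℕ => ∫⁻ x, ENNReal.ofReal (f x * h₀ x ^ (s - 1)) ∂μ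
      + ENNReal.ofReal (C * (1 / ((K : ℝ) + 1)))) atTop
      (𝓝 (∫⁻ x, ENNReal.ofReal (f x * h₀ x ^ (s - 1)) ∂μ + ENNReal.ofReal (C * 0))) :=
    ((ENNReal.continuous_ofReal.tendsto _).comp
      (tendsto_one_div_add_atTop_nhds_zero_nat.const_mul C)).const_add _
  simpa using ge_of_tendsto' hK htrunc

/-- A convex cone of pairs of nonnegative functions `(f, g)` with `‖g‖_t ≤ ‖f‖_s`. -/
structure IsDominatedCone {Ω₁ Ω₂ : Type*} [MeasurableSpace Ω₁] [MeasurableSpace Ω₂]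
    (μ : Measure Ω₁) (ν : Measure Ω₂) (s t : ℝ) (A : Set ((Ω₁ → ℝ) × (Ω₂ → ℝ))) : Prop where
  zero_mem : 0 ∈ A
  add_mem : ∀ a ∈ A, ∀ b ∈ A, a + b ∈ A
  smul_mem : ∀ c : ℝ, 0 ≤ c → ∀ a ∈ A, c • a ∈ A
  measurable_fst : ∀ a ∈ A, Measurable a.1
  measurable_snd : ∀ a ∈ A, Measurable a.2
  fst_nonneg : ∀ a ∈ A, ∀ x, 0 ≤ a.1 x
  snd_nonneg : ∀ a ∈ A, ∀ y, 0 ≤ a.2 y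
  integrable_fst : ∀ a ∈ A, Integrable (fun x => a.1 x ^ s) μ
  integrable_snd : ∀ a ∈ A, Integrable (fun y => a.2 y ^ t) ν
  integral_le : ∀ a ∈ A, ∫ y, a.2 y ^ t ∂ν ≤ (∫ x, a.1 x ^ s ∂μ) ^ (t / s)

/-- The concave functional `(f, g) ↦ t⁻¹ ∫ g ^ t - s⁻¹ ∫ f ^ s`. -/
noncomputable def powerGap {Ω₁ Ω₂ : Type*} [MeasurableSpace Ω₁] [MeasurableSpace Ω₂]
    (μ : Measure Ω₁) (ν : Measure Ω₂) (s t : ℝ) (a : (Ω₁ → ℝ) × (Ω₂ → ℝ)) : ℝ :=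
  (∫ y, a.2 y ^ t ∂ν) / t - (∫ x, a.1 x ^ s ∂μ) / s

namespace IsDominatedCone

variable {Ω₁ Ω₂ : Type*} [MeasurableSpace Ω₁] [MeasurableSpace Ω₂]
  {μ : Measure Ω₁} {ν : Measure Ω₂} {s t : ℝ} {A : Set ((Ω₁ → ℝ) × (Ω₂ → ℝ))}

lemma integral_fst_nonneg (hA : IsDominatedCone μ ν s t A) {a : (Ω₁ → ℝ) × (Ω₂ → ℝ)}
    (ha : a ∈ A) : 0 ≤ ∫ x, a.1 x ^ s ∂μ :=
  integral_nonneg fun x => Real.rpow_nonneg (hA.fst_nonneg a ha x) _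

lemma integral_snd_nonneg (hA : IsDominatedCone μ ν s t A) {a : (Ω₁ → ℝ) × (Ω₂ → ℝ)}
    (ha : a ∈ A) : 0 ≤ ∫ y, a.2 y ^ t ∂ν :=
  integral_nonneg fun y => Real.rpow_nonneg (hA.snd_nonneg a ha y) _

lemma integral_smul_fst (hA : IsDominatedCone μ ν s t A) {a : (Ω₁ → ℝ) × (Ω₂ → ℝ)}
    (ha : a ∈ A) {c : ℝ} (hc : 0 ≤ c) :
    ∫ x, (c • a).1 x ^ s ∂μ = c ^ s * ∫ x, a.1 x ^ s ∂μ := by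
  rw [← integral_const_mul]
  congr 1; ext x
  simp [Real.mul_rpow hc (hA.fst_nonneg a ha x)]

lemma integral_smul_snd (hA : IsDominatedCone μ ν s t A) {a : (Ω₁ → ℝ) × (Ω₂ → ℝ)}
    (ha : a ∈ A) {c : ℝ} (hc : 0 ≤ c) :
    ∫ y, (c • a).2 y ^ t ∂ν = c ^ t * ∫ y, a.2 y ^ t ∂ν := by
  rw [← integral_const_mul]
  congr 1; ext x
  simp [Real.mul_rpow hc (hA.snd_nonneg a ha x)]

lemma powerGap_le (hA : IsDominatedCone μ ν s t A) (ht0 : 0 < t) (ht1 : t < 1) (hs : 1 < s)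
    {a : (Ω₁ → ℝ) × (Ω₂ → ℝ)} (ha : a ∈ A) : powerGap μ ν s t a ≤ 1 / t - 1 / s := by
  have hF := hA.integral_fst_nonneg ha
  set F := ∫ x, a.1 x ^ s ∂μ with hFdef
  have hs0 : s ≠ 0 := by linarith
  have h := rpow_div_sub_rpow_div_le ht0 ht1 hs (Real.rpow_nonneg hF (1 / s))
  rw [← Real.rpow_mul hF, ← Real.rpow_mul hF, one_div_mul_cancel hs0, Real.rpow_one,
    one_div_mul_eq_div] at h
  refine le_trans ?_ h
  rw [powerGap, ← hFdef]
  gcongr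
  exact hA.integral_le a ha

/-- Every element can be rescaled, without decreasing `powerGap`, so that its two integrals
agree. -/
lemma exists_integral_eq (hA : IsDominatedCone μ ν s t A) (ht0 : 0 < t) (ht1 : t < 1)
    (hs : 1 < s) {a : (Ω₁ → ℝ) × (Ω₂ → ℝ)} (ha : a ∈ A) :
    ∃ b ∈ A, powerGap μ ν s t a ≤ powerGap μ ν s t b ∧
      ∫ y, b.2 y ^ t ∂ν = ∫ x, b.1 x ^ s ∂μ ∧ ∫ x, b.1 x ^ s ∂μ ≤ 1 := by
  have hF := hA.integral_fst_nonneg ha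
  have hG := hA.integral_snd_nonneg ha
  have hs0 : 0 < s := by linarith
  rcases hG.eq_or_lt' with hG0 | hG0
  · refine ⟨0, hA.zero_mem, ?_, ?_⟩
    · simp only [powerGap, hG0]
      simp [ht0.ne', hs0.ne']
      positivity
    · simp [ht0.ne', hs0.ne']
  have hF0 : 0 < ∫ x, a.1 x ^ s ∂μ := by
    refine hF.lt_of_ne' fun h => ?_
    have := hA.integral_le a ha
    rw [h, Real.zero_rpow (by positivity)] at this
    linarith
  obtain ⟨c, hc0, hc⟩ : ∃ c : ℝ, 0 < c ∧
      c ^ t * ∫ y, a.2 y ^ t ∂ν = c ^ s * ∫ x, a.1 x ^ s ∂μ := by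
    set F := ∫ x, a.1 x ^ s ∂μ
    set G := ∫ y, a.2 y ^ t ∂ν
    refine ⟨(G / F) ^ (1 / (s - t)), by positivity, ?_⟩
    have hst : s - t ≠ 0 := by linarith
    have : ((G / F) ^ (1 / (s - t))) ^ s = ((G / F) ^ (1 / (s - t))) ^ t * (G / F) := by
      rw [← Real.rpow_mul (by positivity), ← Real.rpow_mul (by positivity)]
      conv_rhs => rw [← Real.rpow_add_one (by positivity)]
      congr 1
      field_simp
      ring
    rw [this]
    field_simp
  have hb := hA.smul_mem c hc0.le a ha
  have hbal : ∫ y, (c • a).2 y ^ t ∂ν = ∫ x, (c • a).1 x ^ s ∂μ := by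
    rw [hA.integral_smul_fst ha hc0.le, hA.integral_smul_snd ha hc0.le, hc]
  refine ⟨c • a, hb, ?_, hbal, ?_⟩
  · have hd := rpow_div_sub_rpow_div_le ht0 ht1 hs (inv_nonneg.2 hc0.le)
    have hH := hA.integral_fst_nonneg hb
    rw [powerGap, powerGap, hbal]
    rw [hA.integral_smul_fst ha hc0.le] at hH ⊢
    have h1 : ∫ y, a.2 y ^ t ∂ν = c⁻¹ ^ t * (c ^ s * ∫ x, a.1 x ^ s ∂μ) := by
      rw [← hc, Real.inv_rpow hc0.le]; field_simp
    have h2 : ∫ x, a.1 x ^ s ∂μ = c⁻¹ ^ s * (c ^ s * ∫ x, a.1 x ^ s ∂μ) := by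
      rw [Real.inv_rpow hc0.le]; field_simp
    rw [h1]
    conv_lhs => rw [h2]
    have h3 : c ^ s * c⁻¹ ^ s = 1 := by
      rw [← Real.mul_rpow hc0.le (by positivity), mul_inv_cancel₀ hc0.ne', Real.one_rpow]
    calc _ = (c⁻¹ ^ t / t - c⁻¹ ^ s / s) * (c ^ s * ∫ x, a.1 x ^ s ∂μ) := by
          linear_combination (c⁻¹ ^ t * c ^ s * (∫ x, a.1 x ^ s ∂μ) / t) * h3
      _ ≤ (1 / t - 1 / s) * (c ^ s * ∫ x, a.1 x ^ s ∂μ) := by gcongr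
      _ = _ := by ring
  · have hle := hA.integral_le _ hb
    rw [hbal] at hle
    by_contra! hlt
    refine absurd hle (not_le.2 ?_)
    calc _ < (∫ x, (c • a).1 x ^ s ∂μ) ^ (1 : ℝ) :=
          Real.rpow_lt_rpow_of_exponent_lt hlt (by rw [div_lt_one hs0]; linarith)
      _ = _ := Real.rpow_one _

/-- Strict concavity of `powerGap`: the distance of two elements is controlled by how far they
are from being maximal. -/
lemma integral_sq_add_integral_sq_le (hA : IsDominatedCone μ ν s t A) (ht0 : 0 < t)
    (ht1 : t < 1) (hs : 1 < s) {S : ℝ} (hS : ∀ a ∈ A, powerGap μ ν s t a ≤ S)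
    {a b : (Ω₁ → ℝ) × (Ω₂ → ℝ)} (ha : a ∈ A) (hb : b ∈ A) :
    Integrable (fun x => (a.1 x ^ (s / 2) - b.1 x ^ (s / 2)) ^ 2) μ ∧
    Integrable (fun y => (a.2 y ^ (t / 2) - b.2 y ^ (t / 2)) ^ 2) ν ∧
    min (s - 1) 1 / (4 * s) * ∫ x, (a.1 x ^ (s / 2) - b.1 x ^ (s / 2)) ^ 2 ∂μ +
      (1 - t) / (4 * t) * ∫ y, (a.2 y ^ (t / 2) - b.2 y ^ (t / 2)) ^ 2 ∂ν ≤
      S - (powerGap μ ν s t a + powerGap μ ν s t b) / 2 := by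
  have hsq : ∀ {e u v : ℝ}, 0 ≤ u → 0 ≤ v → (u ^ (e / 2) - v ^ (e / 2)) ^ 2 ≤
      2 * (u ^ e + v ^ e) := by
    intro e u v hu hv
    have h1 : ∀ {w : ℝ}, 0 ≤ w → w ^ e = (w ^ (e / 2)) ^ 2 := fun {w} hw => by
      rw [← Real.rpow_natCast, ← Real.rpow_mul hw]; congr 1; push_cast; ring
    rw [h1 hu, h1 hv]
    nlinarith [sq_nonneg (u ^ (e / 2) + v ^ (e / 2))]
  have hi1 : Integrable (fun x => (a.1 x ^ (s / 2) - b.1 x ^ (s / 2)) ^ 2) μ := by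
    refine (((hA.integrable_fst a ha).add (hA.integrable_fst b hb)).const_mul 2).mono'
      ((((hA.measurable_fst a ha).pow_const _).sub
        ((hA.measurable_fst b hb).pow_const _)).pow_const 2).aestronglyMeasurable
      (ae_of_all _ fun x => ?_)
    rw [Real.norm_of_nonneg (sq_nonneg _)]
    exact hsq (hA.fst_nonneg a ha x) (hA.fst_nonneg b hb x)
  have hi2 : Integrable (fun y => (a.2 y ^ (t / 2) - b.2 y ^ (t / 2)) ^ 2) ν := by
    refine (((hA.integrable_snd a ha).add (hA.integrable_snd b hb)).const_mul 2).mono'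
      ((((hA.measurable_snd a ha).pow_const _).sub
        ((hA.measurable_snd b hb).pow_const _)).pow_const 2).aestronglyMeasurable
      (ae_of_all _ fun x => ?_)
    rw [Real.norm_of_nonneg (sq_nonneg _)]
    exact hsq (hA.snd_nonneg a ha x) (hA.snd_nonneg b hb x)
  refine ⟨hi1, hi2, ?_⟩
  set m := (1 / 2 : ℝ) • (a + b) with hm
  have hmA : m ∈ A := hA.smul_mem _ (by norm_num) _ (hA.add_mem a ha b hb)
  have hm1 : ∀ x, m.1 x = (a.1 x + b.1 x) / 2 := fun x => by simp [hm]; ring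
  have hm2 : ∀ x, m.2 x = (a.2 x + b.2 x) / 2 := fun x => by simp [hm]; ring
  have hI1 : ∫ x, m.1 x ^ s ∂μ + min (s - 1) 1 / 4 *
      ∫ x, (a.1 x ^ (s / 2) - b.1 x ^ (s / 2)) ^ 2 ∂μ ≤
      (∫ x, a.1 x ^ s ∂μ + ∫ x, b.1 x ^ s ∂μ) / 2 := by
    rw [← integral_const_mul, ← integral_add (hA.integrable_fst m hmA) (hi1.const_mul _),
      ← integral_add (hA.integrable_fst a ha) (hA.integrable_fst b hb), ← integral_div]
    refine integral_mono ((hA.integrable_fst m hmA).add (hi1.const_mul _))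
      (((hA.integrable_fst a ha).add (hA.integrable_fst b hb)).div_const _) fun x => ?_
    simp only [hm1]
    exact rpow_div_two_add_sq_le hs (hA.fst_nonneg a ha x) (hA.fst_nonneg b hb x)
  have hi3 : Integrable (fun y => (a.2 y ^ t + b.2 y ^ t) / 2) ν :=
    ((hA.integrable_snd a ha).add (hA.integrable_snd b hb)).div_const 2
  have hI2 : (∫ x, a.2 x ^ t ∂ν + ∫ x, b.2 x ^ t ∂ν) / 2 + (1 - t) / 4 *
      ∫ x, (a.2 x ^ (t / 2) - b.2 x ^ (t / 2)) ^ 2 ∂ν ≤ ∫ x, m.2 x ^ t ∂ν := by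
    rw [← integral_const_mul, ← integral_add (hA.integrable_snd a ha) (hA.integrable_snd b hb),
      ← integral_div, ← integral_add hi3 (hi2.const_mul _)]
    refine integral_mono (hi3.add (hi2.const_mul _))
      (hA.integrable_snd m hmA) fun x => ?_
    simp only [hm2]
    exact add_rpow_div_two_add_sq_le ht0 ht1 (hA.snd_nonneg a ha x) (hA.snd_nonneg b hb x)
  have hmS := hS m hmA
  simp only [powerGap] at hmS ⊢
  have hs0 : 0 < s := by linarith
  have hJ1 := div_le_div_of_nonneg_right hI1 hs0.le
  have hJ2 := div_le_div_of_nonneg_right hI2 ht0.le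
  have e1 : ∀ c I : ℝ, c / (4 * s) * I = c / 4 * I / s := fun c I => by field_simp
  have e2 : ∀ c I : ℝ, c / (4 * t) * I = c / 4 * I / t := fun c I => by field_simp
  rw [e1, e2]
  simp only [add_div, sub_div] at hJ1 hJ2 ⊢
  linarith [div_right_comm (∫ x, a.1 x ^ s ∂μ) 2 s, div_right_comm (∫ x, b.1 x ^ s ∂μ) 2 s,
    div_right_comm (∫ x, a.2 x ^ t ∂ν) 2 t, div_right_comm (∫ x, b.2 x ^ t ∂ν) 2 t]

/-- The first-order condition satisfied by an almost maximal element `a`. -/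
lemma lintegral_le_lintegral_add (hA : IsDominatedCone μ ν s t A) (ht0 : 0 < t)
    (ht1 : t < 1) (hs : 1 < s) {S ε τ : ℝ} (hS : ∀ a ∈ A, powerGap μ ν s t a ≤ S)
    {a b : (Ω₁ → ℝ) × (Ω₂ → ℝ)} (ha : a ∈ A) (hb : b ∈ A) (hτ : 0 < τ) (hε : 0 ≤ ε)
    (haS : S - ε * τ ≤ powerGap μ ν s t a) :
    ∫⁻ y, ENNReal.ofReal (b.2 y) / ENNReal.ofReal ((a + τ • b).2 y ^ (1 - t)) ∂ν ≤
      ∫⁻ x, ENNReal.ofReal (b.1 x * (a + τ • b).1 x ^ (s - 1)) ∂μ + ENNReal.ofReal ε := by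
  have hs0 : 0 < s := by linarith
  set c := a + τ • b with hc
  have hcA : c ∈ A := hA.add_mem a ha _ (hA.smul_mem τ hτ.le b hb)
  have hc1 : ∀ x, c.1 x = a.1 x + τ * b.1 x := fun x => by simp [hc]
  have hc2 : ∀ x, c.2 x = a.2 x + τ * b.2 x := fun x => by simp [hc]
  have hi1 : Integrable (fun x => (c.1 x ^ s - a.1 x ^ s) / (s * τ)) μ :=
    ((hA.integrable_fst c hcA).sub (hA.integrable_fst a ha)).div_const _
  have hi2 : Integrable (fun y => (c.2 y ^ t - a.2 y ^ t) / (t * τ)) ν :=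
    ((hA.integrable_snd c hcA).sub (hA.integrable_snd a ha)).div_const _
  have hL : ∀ y, ENNReal.ofReal (b.2 y) / ENNReal.ofReal (c.2 y ^ (1 - t)) ≤
      ENNReal.ofReal ((c.2 y ^ t - a.2 y ^ t) / (t * τ)) := by
    intro y
    rcases (hA.snd_nonneg b hb y).eq_or_lt' with h0 | h0
    · simp [h0]
    have ha0 := hA.snd_nonneg a ha y
    have hlt : a.2 y < c.2 y := by rw [hc2]; nlinarith
    have hcy : 0 < c.2 y := ha0.trans_lt hlt
    rw [← ENNReal.ofReal_div_of_pos (by positivity)]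
    apply ENNReal.ofReal_le_ofReal
    have h := mul_rpow_sub_one_le_rpow_sub_rpow ht0 ht1 ha0 hlt
    rw [le_div_iff₀ (by positivity)]
    calc _ = t * ((c.2 y - a.2 y) * c.2 y ^ (t - 1)) := by
          rw [show t - 1 = -(1 - t) by ring, Real.rpow_neg hcy.le, hc2]; field_simp; ring
      _ ≤ _ := h
  have hR : ∀ x, (c.1 x ^ s - a.1 x ^ s) / (s * τ) ≤ b.1 x * c.1 x ^ (s - 1) := by
    intro x
    have hle : a.1 x ≤ c.1 x := by
      rw [hc1]; linarith [mul_nonneg hτ.le (hA.fst_nonneg b hb x)]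
    have h := rpow_sub_rpow_le_mul_rpow_sub_one hs (hA.fst_nonneg a ha x) hle
    rw [div_le_iff₀ (by positivity)]
    calc _ ≤ _ := h
      _ = _ := by
        rw [show c.1 x - a.1 x = τ * b.1 x by rw [hc1]; ring]; ring
  have hnn2 : ∀ y, 0 ≤ (c.2 y ^ t - a.2 y ^ t) / (t * τ) := fun y => by
    refine div_nonneg (sub_nonneg.2 (Real.rpow_le_rpow (hA.snd_nonneg a ha y) ?_ ht0.le))
      (by positivity)
    rw [hc2]; linarith [mul_nonneg hτ.le (hA.snd_nonneg b hb y)]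
  have hnn1 : ∀ x, 0 ≤ (c.1 x ^ s - a.1 x ^ s) / (s * τ) := fun x => by
    refine div_nonneg (sub_nonneg.2 (Real.rpow_le_rpow (hA.fst_nonneg a ha x) ?_ hs0.le))
      (by positivity)
    rw [hc1]; linarith [mul_nonneg hτ.le (hA.fst_nonneg b hb x)]
  have hreal : ∫ y, (c.2 y ^ t - a.2 y ^ t) / (t * τ) ∂ν ≤
      ∫ x, (c.1 x ^ s - a.1 x ^ s) / (s * τ) ∂μ + ε := by
    rw [integral_div, integral_div, integral_sub (hA.integrable_snd c hcA)
      (hA.integrable_snd a ha), integral_sub (hA.integrable_fst c hcA) (hA.integrable_fst a ha)]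
    have h := (hS c hcA).trans (sub_le_iff_le_add.1 haS)
    simp only [powerGap] at h
    have h' : ((∫ y, c.2 y ^ t ∂ν) - ∫ y, a.2 y ^ t ∂ν) / t ≤
        ((∫ x, c.1 x ^ s ∂μ) - ∫ x, a.1 x ^ s ∂μ) / s + ε * τ := by
      simp only [sub_div]; linarith
    have h'' := div_le_div_of_nonneg_right h' hτ.le
    rw [add_div, div_div, div_div, mul_div_cancel_right₀ _ hτ.ne'] at h''
    exact h''
  calc _ ≤ ∫⁻ y, ENNReal.ofReal ((c.2 y ^ t - a.2 y ^ t) / (t * τ)) ∂ν := lintegral_mono hL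
    _ = ENNReal.ofReal (∫ y, (c.2 y ^ t - a.2 y ^ t) / (t * τ) ∂ν) :=
        (ofReal_integral_eq_lintegral_ofReal hi2 (ae_of_all _ hnn2)).symm
    _ ≤ ENNReal.ofReal (∫ x, (c.1 x ^ s - a.1 x ^ s) / (s * τ) ∂μ + ε) :=
        ENNReal.ofReal_le_ofReal hreal
    _ = ∫⁻ x, ENNReal.ofReal ((c.1 x ^ s - a.1 x ^ s) / (s * τ)) ∂μ + ENNReal.ofReal ε := by
        rw [ENNReal.ofReal_add (integral_nonneg hnn1) hε,
          ofReal_integral_eq_lintegral_ofReal hi1 (ae_of_all _ hnn1)]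
    _ ≤ _ := by
        gcongr with x
        exact hR x

/-- A dominated cone admits a pair of weights in the dual unit balls which dominate
simultaneously all its elements. -/
theorem exists_weights (hA : IsDominatedCone μ ν s t A) (ht0 : 0 < t) (ht1 : t < 1)
    (hs : 1 < s) :
    ∃ (w₁ : Ω₁ → ℝ) (w₂ : Ω₂ → ℝ), Measurable w₁ ∧ Measurable w₂ ∧
      (∀ x, 0 ≤ w₁ x) ∧ (∀ y, 0 ≤ w₂ y) ∧
      ∫⁻ x, ENNReal.ofReal (w₁ x ^ (s / (s - 1))) ∂μ ≤ 1 ∧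
      ∫⁻ y, ENNReal.ofReal (w₂ y ^ (t / (1 - t))) ∂ν ≤ 1 ∧
      ∀ b ∈ A, ∫⁻ y, ENNReal.ofReal (b.2 y) / ENNReal.ofReal (w₂ y) ∂ν ≤
        ∫⁻ x, ENNReal.ofReal (b.1 x * w₁ x) ∂μ := by
  have hs0 : 0 < s := by linarith
  have hs1 : 0 < s - 1 := by linarith
  have ht1' : 0 < 1 - t := by linarith
  set S := sSup (powerGap μ ν s t '' A)
  have hbdd : BddAbove (powerGap μ ν s t '' A) := by
    refine ⟨1 / t - 1 / s, ?_⟩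
    rintro _ ⟨a, ha, rfl⟩
    exact hA.powerGap_le ht0 ht1 hs ha
  have hS : ∀ a ∈ A, powerGap μ ν s t a ≤ S := fun a ha => le_csSup hbdd ⟨a, ha, rfl⟩
  have hseq : ∀ n : ℕ, ∃ a ∈ A, S - (1 / 4) ^ n ≤ powerGap μ ν s t a ∧
      ∫ y, a.2 y ^ t ∂ν = ∫ x, a.1 x ^ s ∂μ ∧ ∫ x, a.1 x ^ s ∂μ ≤ 1 := by
    intro n
    obtain ⟨_, ⟨a, ha, rfl⟩, hlt⟩ := exists_lt_of_lt_csSup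
      (Set.Nonempty.image (powerGap μ ν s t) ⟨0, hA.zero_mem⟩)
      (show S - (1 / 4) ^ n < S from sub_lt_self _ (by positivity))
    obtain ⟨b, hb, hab, hbal⟩ := hA.exists_integral_eq ht0 ht1 hs ha
    exact ⟨b, hb, hlt.le.trans hab, hbal⟩
  choose a ha hgap hbal hone using hseq
  have hc1 : 0 < min (s - 1) 1 / (4 * s) := div_pos (lt_min hs1 one_pos) (by positivity)
  have hc2 : 0 < (1 - t) / (4 * t) := by positivity
  have hdist := fun n m => hA.integral_sq_add_integral_sq_le ht0 ht1 hs hS (ha n) (ha m)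
  have hI1 : ∀ n m, 0 ≤ ∫ x, ((a n).1 x ^ (s / 2) - (a m).1 x ^ (s / 2)) ^ 2 ∂μ :=
    fun n m => integral_nonneg fun _ => sq_nonneg _
  have hI2 : ∀ n m, 0 ≤ ∫ y, ((a n).2 y ^ (t / 2) - (a m).2 y ^ (t / 2)) ^ 2 ∂ν :=
    fun n m => integral_nonneg fun _ => sq_nonneg _
  obtain ⟨f, hf, hf0, hflim⟩ := exists_ae_tendsto_of_integral_rpow_sub_sq_le
    (μ := μ) (f := fun n => (a n).1) (e := s / 2) (C := (min (s - 1) 1 / (4 * s))⁻¹)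
    (by positivity) (by positivity) (fun n => hA.measurable_fst _ (ha n))
    (fun n => hA.fst_nonneg _ (ha n)) (fun n m => (hdist n m).1) (fun n m => by
      rw [le_inv_mul_iff₀ hc1]
      linarith [(hdist n m).2.2, hgap n, hgap m, mul_nonneg hc2.le (hI2 n m),
        pow_pos (show (0 : ℝ) < 1 / 4 by norm_num) n, pow_pos (show (0 : ℝ) < 1 / 4 by norm_num) m])
  obtain ⟨g, hg, hg0, hglim⟩ := exists_ae_tendsto_of_integral_rpow_sub_sq_le
    (μ := ν) (f := fun n => (a n).2) (e := t / 2) (C := ((1 - t) / (4 * t))⁻¹)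
    (by positivity) (by positivity) (fun n => hA.measurable_snd _ (ha n))
    (fun n => hA.snd_nonneg _ (ha n)) (fun n m => (hdist n m).2.1) (fun n m => by
      rw [le_inv_mul_iff₀ hc2]
      linarith [(hdist n m).2.2, hgap n, hgap m, mul_nonneg hc1.le (hI1 n m),
        pow_pos (show (0 : ℝ) < 1 / 4 by norm_num) n, pow_pos (show (0 : ℝ) < 1 / 4 by norm_num) m])
  have hFn : ∀ n, ∫⁻ x, ENNReal.ofReal ((a n).1 x ^ s) ∂μ ≤ 1 := fun n => by
    rw [← ofReal_integral_eq_lintegral_ofReal (hA.integrable_fst _ (ha n))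
      (ae_of_all _ fun x => Real.rpow_nonneg (hA.fst_nonneg _ (ha n) x) _)]
    exact ENNReal.ofReal_le_one.2 (hone n)
  have hGn : ∀ n, ∫⁻ y, ENNReal.ofReal ((a n).2 y ^ t) ∂ν ≤ 1 := fun n => by
    rw [← ofReal_integral_eq_lintegral_ofReal (hA.integrable_snd _ (ha n))
      (ae_of_all _ fun x => Real.rpow_nonneg (hA.snd_nonneg _ (ha n) x) _), hbal n]
    exact ENNReal.ofReal_le_one.2 (hone n)
  refine ⟨fun x => f x ^ (s - 1), fun y => g y ^ (1 - t), hf.pow_const _, hg.pow_const _,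
    fun x => Real.rpow_nonneg (hf0 x) _, fun y => Real.rpow_nonneg (hg0 y) _, ?_, ?_, ?_⟩
  · calc _ = ∫⁻ x, liminf (fun n => ENNReal.ofReal ((a n).1 x ^ s)) atTop ∂μ := by
          refine lintegral_congr_ae ?_
          filter_upwards [hflim] with x hx
          rw [← Real.rpow_mul (hf0 x), mul_div_cancel₀ _ hs1.ne']
          exact (((ENNReal.continuous_ofReal.tendsto _).comp
            (hx.rpow_const (Or.inr hs0.le))).liminf_eq).symm
      _ ≤ liminf (fun n => ∫⁻ x, ENNReal.ofReal ((a n).1 x ^ s) ∂μ) atTop :=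
          lintegral_liminf_le fun n =>
            ((hA.measurable_fst _ (ha n)).pow_const _).ennreal_ofReal
      _ ≤ liminf (fun _ => 1) atTop := liminf_le_liminf (Eventually.of_forall hFn)
      _ = 1 := liminf_const _
  · calc _ = ∫⁻ y, liminf (fun n => ENNReal.ofReal ((a n).2 y ^ t)) atTop ∂ν := by
          refine lintegral_congr_ae ?_
          filter_upwards [hglim] with x hx
          rw [← Real.rpow_mul (hg0 x), mul_div_cancel₀ _ ht1'.ne']
          exact (((ENNReal.continuous_ofReal.tendsto _).comp
            (hx.rpow_const (Or.inr ht0.le))).liminf_eq).symm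
      _ ≤ liminf (fun n => ∫⁻ y, ENNReal.ofReal ((a n).2 y ^ t) ∂ν) atTop :=
          lintegral_liminf_le fun n =>
            ((hA.measurable_snd _ (ha n)).pow_const _).ennreal_ofReal
      _ ≤ liminf (fun _ => 1) atTop := liminf_le_liminf (Eventually.of_forall hGn)
      _ = 1 := liminf_const _
  intro b hb
  set τ : ℕ → ℝ := fun n => (1 / 2) ^ n
  have hτ0 : ∀ n, 0 < τ n := fun n => by positivity
  have hτ1 : ∀ n, τ n ≤ 1 := fun n => pow_le_one₀ (by norm_num) (by norm_num)
  have hτlim : Tendsto τ atTop (𝓝 0) :=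
    tendsto_pow_atTop_nhds_zero_of_lt_one (by norm_num) (by norm_num)
  have hcA : ∀ n, a n + τ n • b ∈ A := fun n =>
    hA.add_mem _ (ha n) _ (hA.smul_mem _ (hτ0 n).le b hb)
  have hfirst : ∀ n, ∫⁻ y, ENNReal.ofReal (b.2 y) /
      ENNReal.ofReal ((a n + τ n • b).2 y ^ (1 - t)) ∂ν ≤
      ∫⁻ x, ENNReal.ofReal (b.1 x * (a n + τ n • b).1 x ^ (s - 1)) ∂μ + ENNReal.ofReal (τ n) := by
    intro n
    refine hA.lintegral_le_lintegral_add ht0 ht1 hs hS (ha n) hb (hτ0 n) (hτ0 n).le ?_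
    rw [show τ n * τ n = (1 / 4) ^ n by rw [← mul_pow]; norm_num]
    exact hgap n
  have hlim1 : ∀ᵐ x ∂μ, Tendsto (fun n => (a n + τ n • b).1 x) atTop (𝓝 (f x)) := by
    filter_upwards [hflim] with x hx
    simpa using hx.add (hτlim.mul_const (b.1 x))
  have hlim2 : ∀ᵐ y ∂ν, Tendsto (fun n => (a n + τ n • b).2 y) atTop (𝓝 (g y)) := by
    filter_upwards [hglim] with y hy
    simpa using hy.add (hτlim.mul_const (b.2 y))
  have hbound : ∀ n, ∫⁻ x, ENNReal.ofReal ((a n + τ n • b).1 x ^ s) ∂μ ≤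
      ENNReal.ofReal (2 ^ s * ((1 + ∫ x, b.1 x ^ s ∂μ) / 2)) := by
    intro n
    rw [← ofReal_integral_eq_lintegral_ofReal (hA.integrable_fst _ (hcA n))
      (ae_of_all _ fun x => Real.rpow_nonneg (hA.fst_nonneg _ (hcA n) x) _)]
    apply ENNReal.ofReal_le_ofReal
    calc _ ≤ ∫ x, 2 ^ s * (((a n).1 x ^ s + b.1 x ^ s) / 2) ∂μ := by
          refine integral_mono (hA.integrable_fst _ (hcA n)) ((((hA.integrable_fst _ (ha n)).add
            (hA.integrable_fst b hb)).div_const 2).const_mul _) fun x => ?_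
          have hax := hA.fst_nonneg _ (ha n) x
          have hbx := hA.fst_nonneg b hb x
          have hconv := rpow_div_two_add_sq_le hs hax hbx
          have hsq := mul_nonneg (div_nonneg (le_min hs1.le zero_le_one) zero_le_four)
            (sq_nonneg ((a n).1 x ^ (s / 2) - b.1 x ^ (s / 2)))
          calc (a n + τ n • b).1 x ^ s ≤ (2 * (((a n).1 x + b.1 x) / 2)) ^ s := by
                refine Real.rpow_le_rpow (hA.fst_nonneg _ (hcA n) x) ?_ hs0.le
                have := mul_le_of_le_one_left hbx (hτ1 n)
                simp only [Prod.fst_add, Prod.smul_fst, Pi.add_apply, Pi.smul_apply, smul_eq_mul]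
                linarith
            _ = 2 ^ s * (((a n).1 x + b.1 x) / 2) ^ s := Real.mul_rpow (by norm_num) (by positivity)
            _ ≤ _ := by
                refine mul_le_mul_of_nonneg_left ?_ (by positivity)
                linarith
      _ = 2 ^ s * ((∫ x, (a n).1 x ^ s ∂μ + ∫ x, b.1 x ^ s ∂μ) / 2) := by
          rw [integral_const_mul, integral_div, integral_add (hA.integrable_fst _ (ha n))
            (hA.integrable_fst b hb)]
      _ ≤ _ := by
          gcongr
          exact hone n
  calc _ = ∫⁻ y, liminf (fun n => ENNReal.ofReal (b.2 y) /
        ENNReal.ofReal ((a n + τ n • b).2 y ^ (1 - t))) atTop ∂ν := by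
        refine lintegral_congr_ae ?_
        filter_upwards [hlim2] with y hy
        exact (ENNReal.Tendsto.const_div ((ENNReal.continuous_ofReal.tendsto _).comp
          (hy.rpow_const (Or.inr ht1'.le))) (Or.inr ENNReal.ofReal_ne_top)).liminf_eq.symm
    _ ≤ liminf (fun n => ∫⁻ y, ENNReal.ofReal (b.2 y) /
        ENNReal.ofReal ((a n + τ n • b).2 y ^ (1 - t)) ∂ν) atTop :=
        lintegral_liminf_le fun n => (hA.measurable_snd b hb).ennreal_ofReal.div
          ((hA.measurable_snd _ (hcA n)).pow_const _).ennreal_ofReal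
    _ ≤ liminf (fun n => ∫⁻ x, ENNReal.ofReal (b.1 x * (a n + τ n • b).1 x ^ (s - 1)) ∂μ
        + ENNReal.ofReal (τ n)) atTop := liminf_le_liminf (Eventually.of_forall hfirst)
    _ ≤ _ := by
        refine liminf_lintegral_mul_rpow_sub_one_le hs (hA.measurable_fst b hb)
          (hA.fst_nonneg b hb) (hA.integrable_fst b hb) (fun n => hA.measurable_fst _ (hcA n))
          (fun n => hA.fst_nonneg _ (hcA n)) hbound hlim1 ?_
        simpa [Function.comp_def] using (ENNReal.continuous_ofReal.tendsto _).comp hτlim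

end IsDominatedCone

/-- The sums `∑ ‖x k‖ ^ r` belong to `L^{q / r}` when the `x k` belong to `L^q`. -/
lemma integrable_sum_norm_rpow_rpow {Ω ι E : Type*} [MeasurableSpace Ω] [Fintype ι]
    {μ : Measure Ω} [NormedAddCommGroup E] {q r : ℝ} (hr : 0 < r) (hq : 0 < q)
    (x : ι → Lp E (ENNReal.ofReal q) μ) :
    Integrable (fun ω => (∑ k, ‖x k ω‖ ^ r) ^ (q / r)) μ := by
  have hmem : MemLp (fun ω => ∑ k, ‖x k ω‖ ^ r) (ENNReal.ofReal (q / r)) μ := by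
    refine memLp_finsetSum _ fun k _ => ?_
    have := (Lp.memLp (x k)).norm_rpow_div (ENNReal.ofReal r)
    rwa [ENNReal.toReal_ofReal hr.le, ← ENNReal.ofReal_div_of_pos hr] at this
  have hpos : 0 < q / r := by positivity
  refine (hmem.integrable_norm_rpow (by simpa using hpos) ENNReal.ofReal_ne_top).congr
    (ae_of_all _ fun ω => ?_)
  simp only [ENNReal.toReal_ofReal hpos.le]
  rw [Real.norm_of_nonneg (Finset.sum_nonneg fun k _ => by positivity)]

/-- An exponent version of the normalization of a weight. -/
lemma eLpNorm_ofReal_le_one {Ω : Type*} [MeasurableSpace Ω] {μ : Measure Ω} {w : Ω → ℝ} {e : ℝ}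
    (he : 0 < e) (hw : ∀ x, 0 ≤ w x) (hle : ∫⁻ x, ENNReal.ofReal (w x ^ e) ∂μ ≤ 1) :
    eLpNorm w (ENNReal.ofReal e) μ ≤ 1 := by
  rw [eLpNorm_eq_lintegral_rpow_enorm_toReal (by simpa using he) ENNReal.ofReal_ne_top,
    ENNReal.toReal_ofReal he.le]
  refine ENNReal.rpow_le_one ?_ (by positivity)
  convert hle using 3 with x
  rw [Real.enorm_of_nonneg (hw x), ENNReal.ofReal_rpow_of_nonneg (hw x) he.le]

/-- The pairs `(∑ ‖x k‖ ^ r, ∑ ‖T (x k)‖ ^ r)` form a dominated cone. -/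
lemma isDominatedCone_of_lintegral_le
    {Ω₁ Ω₂ : Type*} [MeasurableSpace Ω₁] [MeasurableSpace Ω₂]
    {μ : Measure Ω₁} {ν : Measure Ω₂} {E F : Type*} [NormedAddCommGroup E] [NormedSpace ℝ E]
    [NormedAddCommGroup F] [NormedSpace ℝ F] {p r q : ℝ} (hp : 0 < p) (hr : 0 < r) (hq : 0 < q)
    {T : Lp E (ENNReal.ofReal q) μ → Lp F (ENNReal.ofReal p) ν}
    (hThom : ∀ (c : ℝ), 0 ≤ c → ∀ x, T (c • x) = c • T x)
    (hmain : ∀ (n : ℕ) (x : Fin n → Lp E (ENNReal.ofReal q) μ),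
      (∫⁻ ω₂, ENNReal.ofReal ((∑ k, ‖T (x k) ω₂‖ ^ r) ^ (p / r)) ∂ν) ^ (1 / p) ≤
        (∫⁻ ω₁, ENNReal.ofReal ((∑ k, ‖x k ω₁‖ ^ r) ^ (q / r)) ∂μ) ^ (1 / q)) :
    IsDominatedCone μ ν (q / r) (p / r)
      {a | (Measurable a.1 ∧ Measurable a.2) ∧ ((∀ x, 0 ≤ a.1 x) ∧ ∀ y, 0 ≤ a.2 y) ∧
        ∃ (n : ℕ) (x : Fin n → Lp E (ENNReal.ofReal q) μ),
          a.1 =ᵐ[μ] (fun ω => ∑ k, ‖x k ω‖ ^ r) ∧ a.2 =ᵐ[ν] fun ω => ∑ k, ‖T (x k) ω‖ ^ r} where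
  zero_mem := by
    refine ⟨⟨measurable_const, measurable_const⟩, ⟨fun _ => le_rfl, fun _ => le_rfl⟩, 0,
      Fin.elim0, ?_, ?_⟩ <;> simp <;> rfl
  add_mem := by
    rintro a ⟨ham, han, n, x, hx1, hx2⟩ b ⟨hbm, hbn, m, y, hy1, hy2⟩
    refine ⟨⟨ham.1.add hbm.1, ham.2.add hbm.2⟩, ⟨fun z => add_nonneg (han.1 z) (hbn.1 z),
      fun z => add_nonneg (han.2 z) (hbn.2 z)⟩, n + m, Fin.append x y, ?_, ?_⟩
    · filter_upwards [hx1, hy1] with ω h1 h2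
      simp [Fin.sum_univ_add, h1, h2]
    · filter_upwards [hx2, hy2] with ω h1 h2
      simp [Fin.sum_univ_add, h1, h2]
  smul_mem := by
    rintro c hc a ⟨ham, han, n, x, hx1, hx2⟩
    have hcr : (c ^ (1 / r)) ^ r = c := by
      rw [← Real.rpow_mul hc, one_div_mul_cancel hr.ne', Real.rpow_one]
    have hc' : 0 ≤ c ^ (1 / r) := Real.rpow_nonneg hc _
    refine ⟨⟨ham.1.const_smul c, ham.2.const_smul c⟩, ⟨fun z => mul_nonneg hc (han.1 z),
      fun z => mul_nonneg hc (han.2 z)⟩, n, fun k => c ^ (1 / r) • x k, ?_, ?_⟩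
    · filter_upwards [hx1, ae_all_iff.2 fun k => Lp.coeFn_smul (c ^ (1 / r)) (x k)] with ω h1 h2
      simp only [Prod.smul_fst, Pi.smul_apply, h1, h2, norm_smul, Real.norm_of_nonneg hc',
        Real.mul_rpow hc' (norm_nonneg _), hcr, smul_eq_mul, Finset.mul_sum]
    · filter_upwards [hx2, ae_all_iff.2 fun k => Lp.coeFn_smul (c ^ (1 / r)) (T (x k))] with ω h1 h2
      simp only [Prod.smul_snd, hThom _ hc', Pi.smul_apply, h1, h2, norm_smul,
        Real.norm_of_nonneg hc', Real.mul_rpow hc' (norm_nonneg _), hcr, smul_eq_mul,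
        Finset.mul_sum]
  measurable_fst := fun a ha => ha.1.1
  measurable_snd := fun a ha => ha.1.2
  fst_nonneg := fun a ha => ha.2.1.1
  snd_nonneg := fun a ha => ha.2.1.2
  integrable_fst := by
    rintro a ⟨-, -, n, x, hx1, -⟩
    refine (integrable_sum_norm_rpow_rpow hr hq x).congr ?_
    filter_upwards [hx1] with ω h
    rw [h]
  integrable_snd := by
    rintro a ⟨-, -, n, x, -, hx2⟩
    refine (integrable_sum_norm_rpow_rpow hr hp fun k => T (x k)).congr ?_
    filter_upwards [hx2] with ω h
    rw [h]
  integral_le := by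
    rintro a ⟨-, -, n, x, hx1, hx2⟩
    have h1 : ∫ ω, a.1 ω ^ (q / r) ∂μ = ∫ ω, (∑ k, ‖x k ω‖ ^ r) ^ (q / r) ∂μ := by
      refine integral_congr_ae ?_
      filter_upwards [hx1] with ω h
      rw [h]
    have h2 : ∫ ω, a.2 ω ^ (p / r) ∂ν = ∫ ω, (∑ k, ‖T (x k) ω‖ ^ r) ^ (p / r) ∂ν := by
      refine integral_congr_ae ?_
      filter_upwards [hx2] with ω h
      rw [h]
    have hnn1 : ∀ ω, 0 ≤ (∑ k, ‖x k ω‖ ^ r) ^ (q / r) := fun ω => by positivity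
    have hnn2 : ∀ ω, 0 ≤ (∑ k, ‖T (x k) ω‖ ^ r) ^ (p / r) := fun ω => by positivity
    have hle := hmain n x
    rw [← ofReal_integral_eq_lintegral_ofReal (integrable_sum_norm_rpow_rpow hr hq x)
      (ae_of_all _ hnn1), ← ofReal_integral_eq_lintegral_ofReal
      (integrable_sum_norm_rpow_rpow hr hp fun k => T (x k)) (ae_of_all _ hnn2),
      ENNReal.ofReal_rpow_of_nonneg (integral_nonneg hnn1) (by positivity),
      ENNReal.ofReal_rpow_of_nonneg (integral_nonneg hnn2) (by positivity),
      ENNReal.ofReal_le_ofReal_iff (Real.rpow_nonneg (integral_nonneg hnn1) _), ← h1, ← h2] at hle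
    have hF : 0 ≤ ∫ ω, a.1 ω ^ (q / r) ∂μ := h1 ▸ integral_nonneg hnn1
    have hG : 0 ≤ ∫ ω, a.2 ω ^ (p / r) ∂ν := h2 ▸ integral_nonneg hnn2
    have h := Real.rpow_le_rpow (Real.rpow_nonneg hG _) hle hp.le
    rw [← Real.rpow_mul hG, ← Real.rpow_mul hF, one_div_mul_cancel hp.ne', Real.rpow_one] at h
    convert h using 2
    field_simp

/-- **Corollary 8** of the paper for `X = L^q(μ)`, `Y = L^p(ν)` (`1 ≤ p < r < q`):
a homogeneous operator `T : L^q(μ;E) → L^p(ν;F)` between Bochner spaces satisfying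
the vector-valued norm inequality (4.1) admits weights `w₁, w₂ ≥ 0` with
`‖w₁‖_{L^{q/(q-r)}(μ)} ≤ 1`, `‖w₂‖_{L^{p/(r-p)}(ν)} ≤ 1` such that
`∫ ‖Tx‖_F^r / w₂ dν ≤ ∫ ‖x‖_E^r w₁ dμ` for all `x`. -/
theorem maurey_rosenthal_bochner
    {Ω₁ Ω₂ : Type*} [MeasurableSpace Ω₁] [MeasurableSpace Ω₂]
    (μ : Measure Ω₁) (ν : Measure Ω₂) [SigmaFinite μ] [SigmaFinite ν]
    {E F : Type*} [NormedAddCommGroup E] [NormedSpace ℝ E] [CompleteSpace E]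
    [NormedAddCommGroup F] [NormedSpace ℝ F] [CompleteSpace F]
    (p r q : ℝ) (hp : 1 ≤ p) (hpr : p < r) (hrq : r < q)
    (T : Lp E (ENNReal.ofReal q) μ → Lp F (ENNReal.ofReal p) ν)
    (hThom : ∀ (c : ℝ), 0 ≤ c → ∀ x, T (c • x) = c • T x)
    (hmain : ∀ (n : ℕ) (x : Fin n → Lp E (ENNReal.ofReal q) μ),
      (∫⁻ ω₂, ENNReal.ofReal ((∑ k, ‖T (x k) ω₂‖ ^ r) ^ (p / r)) ∂ν) ^ (1 / p) ≤
        (∫⁻ ω₁, ENNReal.ofReal ((∑ k, ‖x k ω₁‖ ^ r) ^ (q / r)) ∂μ) ^ (1 / q)) :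
    ∃ (w₁ : Ω₁ → ℝ) (w₂ : Ω₂ → ℝ),
      Measurable w₁ ∧ Measurable w₂ ∧
      (∀ ω, 0 ≤ w₁ ω) ∧ (∀ ω, 0 ≤ w₂ ω) ∧
      eLpNorm w₁ (ENNReal.ofReal (q / (q - r))) μ ≤ 1 ∧
      eLpNorm w₂ (ENNReal.ofReal (p / (r - p))) ν ≤ 1 ∧
      ∀ x : Lp E (ENNReal.ofReal q) μ,
        ∫⁻ ω, ENNReal.ofReal (‖T x ω‖ ^ r) / ENNReal.ofReal (w₂ ω) ∂ν ≤
          ∫⁻ ω, ENNReal.ofReal (‖x ω‖ ^ r * w₁ ω) ∂μ := by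
  have hp0 : 0 < p := by linarith
  have hr0 : 0 < r := by linarith
  have hq0 : 0 < q := by linarith
  have hA := isDominatedCone_of_lintegral_le hp0 hr0 hq0 hThom hmain
  obtain ⟨w₁, w₂, hm1, hm2, hn1, hn2, hi1, hi2, hle⟩ := hA.exists_weights (by positivity)
    ((div_lt_one hr0).2 hpr) ((one_lt_div hr0).2 hrq)
  have hrq' : 0 < q - r := by linarith
  have hpr' : 0 < r - p := by linarith
  rw [show q / r / (q / r - 1) = q / (q - r) by field_simp] at hi1
  rw [show p / r / (1 - p / r) = p / (r - p) by field_simp] at hi2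
  refine ⟨w₁, w₂, hm1, hm2, hn1, hn2, eLpNorm_ofReal_le_one (by positivity) hn1 hi1,
    eLpNorm_ofReal_le_one (by positivity) hn2 hi2, fun x => ?_⟩
  refine hle (fun ω => ‖x ω‖ ^ r, fun ω => ‖T x ω‖ ^ r)
    ⟨⟨(Lp.stronglyMeasurable x).norm.measurable.pow_const r,
      (Lp.stronglyMeasurable (T x)).norm.measurable.pow_const r⟩,
      ⟨fun ω => by positivity, fun ω => by positivity⟩, 1, fun _ => x, ?_, ?_⟩
  · simp
  · simp
end

section
/- There exists a universal constant K with the following property: for all σ-finite measure spaces (Ω₁,μ) and (Ω₂,ν), all 2 ≤ s, t < ∞, and every bounded bilinear form u : L^s(μ) × L^t(ν) → ℝ, there exist measurable functions φ : Ω₁ → [0,∞) and ψ : Ω₂ → [0,∞) with ‖φ‖_{L^{(s/2)'}(μ)} ≤ 1 and ‖ψ‖_{L^{(t/2)'}(ν)} ≤ 1 such that for all x ∈ L^s(μ) and y ∈ L^t(ν), |u(x,y)| ≤ K ‖u‖ (∫ x² φ dμ)^{1/2} (∫ y² ψ dν)^{1/2}, where ‖u‖ := sup{|u(x,y)| : ‖x‖_{L^s(μ)}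 ≤ 1, ‖y‖_{L^t(ν)} ≤ 1}. -/
open MeasureTheory ENNReal
open scoped NNReal ENNReal

universe u v

/-- Second and fourth moments of Rademacher sums. -/
theorem exists_rademacher {ι : Type} (s : Finset ι) :
    ∃ (Ω : Type) (_ : Fintype Ω) (_ : Nonempty Ω) (r : ι → Ω → ℝ),
      (∀ v w : ι → ℝ, ∑ ω, (∑ i ∈ s, v i * r i ω) * (∑ i ∈ s, w i * r i ω) =
        Fintype.card Ω * ∑ i ∈ s, v i * w i) ∧
      (∀ v : ι → ℝ, ∑ ω, (∑ i ∈ s, v i * r i ω) ^ 4 ≤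
        3 * Fintype.card Ω * (∑ i ∈ s, v i ^ 2) ^ 2) := by
  classical
  induction s using Finset.induction_on with
  | empty => exact ⟨Unit, inferInstance, inferInstance, fun _ _ => 0, by simp, by simp⟩
  | insert a s ha ih =>
    obtain ⟨Ω, hΩ, hne, r, h2, h4⟩ := ih
    have key : ∀ (v : ι → ℝ) (ω : Ω) (b : Bool),
        ∑ i ∈ insert a s, v i * (if i = a then (if b then 1 else -1) else r i ω) =
          v a * (if b then 1 else -1) + ∑ i ∈ s, v i * r i ω := by
      intro v ω b
      rw [Finset.sum_insert ha, if_pos rfl]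
      congr 1
      refine Finset.sum_congr rfl fun i hi => ?_
      rw [if_neg (ne_of_mem_of_not_mem hi ha)]
    refine ⟨Ω × Bool, inferInstance, inferInstance,
      fun i ω => if i = a then (if ω.2 then 1 else -1) else r i ω.1, fun v w => ?_, fun v => ?_⟩
    · simp only [Fintype.sum_prod_type, key, Fintype.sum_bool, Finset.sum_insert ha,
        Fintype.card_prod, Fintype.card_bool]
      have : ∀ ω : Ω, (v a * (if true then 1 else -1) + ∑ i ∈ s, v i * r i ω) *
          (w a * (if true then 1 else -1) + ∑ i ∈ s, w i * r i ω) +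
          (v a * (if false then 1 else -1) + ∑ i ∈ s, v i * r i ω) *
          (w a * (if false then 1 else -1) + ∑ i ∈ s, w i * r i ω) =
          2 * (v a * w a) + 2 * ((∑ i ∈ s, v i * r i ω) * ∑ i ∈ s, w i * r i ω) := by
        intro ω; simp; ring
      simp only [Bool.false_eq_true, if_true, if_false] at this ⊢
      simp only [this, Finset.sum_add_distrib, ← Finset.mul_sum, h2]
      simp
      ring
    · simp only [Fintype.sum_prod_type, key, Fintype.sum_bool, Finset.sum_insert ha,
        Fintype.card_prod, Fintype.card_bool]
      have : ∀ ω : Ω, (v a * (if true then 1 else -1) + ∑ i ∈ s, v i * r i ω) ^ 4 +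
          (v a * (if false then 1 else -1) + ∑ i ∈ s, v i * r i ω) ^ 4 =
          2 * v a ^ 4 + 12 * v a ^ 2 * ((∑ i ∈ s, v i * r i ω) * ∑ i ∈ s, v i * r i ω)
            + 2 * (∑ i ∈ s, v i * r i ω) ^ 4 := by
        intro ω; simp; ring
      simp only [Bool.false_eq_true, if_true, if_false] at this ⊢
      simp only [this, Finset.sum_add_distrib, ← Finset.mul_sum, h2]
      have h := h4 v
      have hn : (0 : ℝ) ≤ Fintype.card Ω := by positivity
      have hs : ∑ i ∈ s, v i * v i = ∑ i ∈ s, v i ^ 2 := by simp only [sq]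
      rw [hs]
      simp
      nlinarith [mul_nonneg hn (sq_nonneg (v a ^ 2))]

open Finset in
/-- **Grothendieck's inequality** for real matrices, with the constant `98`. -/
theorem grothendieck_inequality {α β ι : Type*} [Fintype ι] (S : Finset α) (T : Finset β)
    (b : α → β → ℝ) (M : ℝ)
    (hb : ∀ (ε : α → ℝ) (δ : β → ℝ), (∀ i, |ε i| ≤ 1) → (∀ j, |δ j| ≤ 1) →
      |∑ i ∈ S, ∑ j ∈ T, b i j * (ε i * δ j)| ≤ M)
    (v : α → ι → ℝ) (w : β → ι → ℝ) (hv : ∀ i, ∑ k, v i k ^ 2 ≤ 1)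
    (hw : ∀ j, ∑ k, w j k ^ 2 ≤ 1) :
    |∑ i ∈ S, ∑ j ∈ T, b i j * ∑ k, v i k * w j k| ≤ 98 * M := by
  let valid : ℝ → Prop := fun G => ∀ (ι : Type) (_ : Fintype ι) (v : α → ι → ℝ) (w : β → ι → ℝ),
    (∀ i, ∑ k, v i k ^ 2 ≤ 1) → (∀ j, ∑ k, w j k ^ 2 ≤ 1) →
      |∑ i ∈ S, ∑ j ∈ T, b i j * ∑ k, v i k * w j k| ≤ G
  have hvalid0 : valid (∑ i ∈ S, ∑ j ∈ T, |b i j|) := by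
    intro ι _ v w hv hw
    refine (abs_sum_le_sum_abs _ _).trans (sum_le_sum fun i _ => ?_)
    refine (abs_sum_le_sum_abs _ _).trans (sum_le_sum fun j _ => ?_)
    rw [abs_mul]
    refine mul_le_of_le_one_right (abs_nonneg _) ?_
    have h1 : ∑ k, v i k * w j k ≤ ∑ k, (v i k ^ 2 + w j k ^ 2) / 2 :=
      sum_le_sum fun k _ => by nlinarith [sq_nonneg (v i k - w j k)]
    have h2 : ∑ k, -((v i k ^ 2 + w j k ^ 2) / 2) ≤ ∑ k, v i k * w j k :=
      sum_le_sum fun k _ => by nlinarith [sq_nonneg (v i k + w j k)]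
    rw [sum_neg_distrib] at h2
    rw [← sum_div, sum_add_distrib] at h1 h2
    rw [abs_le]
    constructor <;> linarith [hv i, hw j]
  have hnonneg : ∀ G, valid G → 0 ≤ G := fun G hG => by
    simpa using hG Empty inferInstance (fun _ => Empty.elim) (fun _ => Empty.elim)
      (by simp) (by simp)
  have hstep : ∀ G, valid G → valid (49 * M + G / 2) := by
    intro G hG ι _ v w hv hw
    obtain ⟨Ω, _, _, r, h2, h4⟩ := exists_rademacher (Finset.univ : Finset ι)
    set N : ℝ := (Fintype.card Ω : ℝ) with hN
    have hNpos : 0 < N := by rw [hN]; exact_mod_cast Fintype.card_pos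
    let small : ℝ → ℝ := fun z => if |z| ≤ 7 then z else 0
    let large : ℝ → ℝ := fun z => z - small z
    have hsmall : ∀ z, |small z| ≤ 7 := by
      intro z; simp only [small]; split_ifs with h
      · exact h
      · simp
    have hsmall2 : ∀ z, small z ^ 2 ≤ z * z := by
      intro z; simp only [small]; split_ifs with h <;> nlinarith [sq_nonneg z]
    have hlarge : ∀ z, 49 * large z ^ 2 ≤ z ^ 4 := by
      intro z; simp only [large, small]; split_ifs with h
      · simp; positivity
      · have : 49 ≤ z ^ 2 := by rw [← sq_abs]; nlinarith [not_le.1 h]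
        nlinarith [sq_nonneg z]
    let X : α → Ω → ℝ := fun i ω => ∑ k, v i k * r k ω
    let Y : β → Ω → ℝ := fun j ω => ∑ k, w j k * r k ω
    have hmom : ∀ z : ι → ℝ, ∑ k, z k ^ 2 ≤ 1 →
        ∑ ω, small (∑ k, z k * r k ω) ^ 2 ≤ N ∧ ∑ ω, (∑ k, z k * r k ω) ^ 2 ≤ N ∧
          ∑ ω, 16 * large (∑ k, z k * r k ω) ^ 2 ≤ N := by
      intro z hz
      have e2 := h2 z z
      have e4 := h4 z
      have hz0 : 0 ≤ ∑ k, z k ^ 2 := sum_nonneg fun k _ => sq_nonneg _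
      simp only [← sq] at e2
      have hle : ∑ ω, (∑ k, z k * r k ω) ^ 2 ≤ N := by rw [e2]; nlinarith
      refine ⟨le_trans (sum_le_sum fun ω _ => ?_) hle, hle, ?_⟩
      · rw [sq (∑ k, z k * r k ω)]; exact hsmall2 _
      · have : ∑ ω, 49 * large (∑ k, z k * r k ω) ^ 2 ≤ 3 * N * (∑ k, z k ^ 2) ^ 2 :=
          le_trans (sum_le_sum fun ω _ => hlarge _) e4
        have h3 : (∑ k, z k ^ 2) ^ 2 ≤ 1 := by nlinarith
        rw [← mul_sum] at this ⊢
        nlinarith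
    have hsqrt : (√N)⁻¹ ^ 2 = N⁻¹ := by rw [inv_pow, Real.sq_sqrt hNpos.le]
    have happ : ∀ (x : α → Ω → ℝ) (y : β → Ω → ℝ), (∀ i, ∑ ω, x i ω ^ 2 ≤ N) →
        (∀ j, ∑ ω, y j ω ^ 2 ≤ N) →
        |∑ i ∈ S, ∑ j ∈ T, b i j * ∑ ω, x i ω * y j ω| ≤ N * G := by
      intro x y hx hy
      have := hG Ω inferInstance (fun i ω => (√N)⁻¹ * x i ω) (fun j ω => (√N)⁻¹ * y j ω)
        (fun i => by
          simp only [mul_pow, ← mul_sum, hsqrt]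
          rw [inv_mul_le_iff₀ hNpos]; linarith [hx i])
        (fun j => by
          simp only [mul_pow, ← mul_sum, hsqrt]
          rw [inv_mul_le_iff₀ hNpos]; linarith [hy j])
      have e : ∀ i j, b i j * ∑ ω, (√N)⁻¹ * x i ω * ((√N)⁻¹ * y j ω) =
          N⁻¹ * (b i j * ∑ ω, x i ω * y j ω) := by
        intro i j
        rw [← hsqrt, mul_left_comm, mul_sum univ _ ((√N)⁻¹ ^ 2)]
        congr 1
        exact sum_congr rfl fun ω _ => by ring
      simp only [e, ← mul_sum, abs_mul, abs_inv, abs_of_pos hNpos] at this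
      rwa [inv_mul_le_iff₀ hNpos] at this
    have hA : |∑ i ∈ S, ∑ j ∈ T, b i j * ∑ ω, small (X i ω) * small (Y j ω)| ≤ N * (49 * M) := by
      have e : ∑ i ∈ S, ∑ j ∈ T, b i j * ∑ ω, small (X i ω) * small (Y j ω) =
          ∑ ω, 49 * ∑ i ∈ S, ∑ j ∈ T, b i j * (small (X i ω) / 7 * (small (Y j ω) / 7)) := by
        simp only [mul_sum]
        rw [sum_comm (s := univ)]
        refine sum_congr rfl fun i _ => ?_
        rw [sum_comm (s := univ)]
        exact sum_congr rfl fun j _ => sum_congr rfl fun k _ => by ring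
      rw [e]
      refine (abs_sum_le_sum_abs _ _).trans ?_
      have : ∀ ω ∈ (univ : Finset Ω), |49 * ∑ i ∈ S, ∑ j ∈ T,
          b i j * (small (X i ω) / 7 * (small (Y j ω) / 7))| ≤ 49 * M := by
        intro ω _
        rw [abs_mul, abs_of_pos (by norm_num : (0:ℝ) < 49)]
        refine mul_le_mul_of_nonneg_left (hb _ _ ?_ ?_) (by norm_num)
        · intro i; rw [abs_div, abs_of_pos (by norm_num : (0:ℝ) < 7)]; linarith [hsmall (X i ω)]
        · intro i; rw [abs_div, abs_of_pos (by norm_num : (0:ℝ) < 7)]; linarith [hsmall (Y i ω)]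
      refine (sum_le_sum this).trans ?_
      simp [hN]
    have hB := happ (fun i ω => small (X i ω)) (fun j ω => 4 * large (Y j ω))
      (fun i => (hmom _ (hv i)).1)
      (fun j => by simpa [mul_pow, Y, show (4:ℝ)^2 = 16 by norm_num] using (hmom _ (hw j)).2.2)
    have hC := happ (fun i ω => 4 * large (X i ω)) (fun j ω => Y j ω)
      (fun i => by simpa [mul_pow, X, show (4:ℝ)^2 = 16 by norm_num] using (hmom _ (hv i)).2.2)
      (fun j => (hmom _ (hw j)).2.1)
    have hsplit : N * ∑ i ∈ S, ∑ j ∈ T, b i j * ∑ k, v i k * w j k =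
        ∑ i ∈ S, ∑ j ∈ T, b i j * ∑ ω, small (X i ω) * small (Y j ω) +
        (∑ i ∈ S, ∑ j ∈ T, b i j * ∑ ω, small (X i ω) * (4 * large (Y j ω))) / 4 +
        (∑ i ∈ S, ∑ j ∈ T, b i j * ∑ ω, 4 * large (X i ω) * Y j ω) / 4 := by
      simp only [sum_div, ← sum_add_distrib]
      rw [mul_sum]
      refine sum_congr rfl fun i _ => ?_
      rw [mul_sum]
      refine sum_congr rfl fun j _ => ?_
      rw [mul_left_comm, ← h2, mul_div_assoc, mul_div_assoc, ← mul_add, ← mul_add, sum_div,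
        sum_div, ← sum_add_distrib, ← sum_add_distrib]
      congr 1
      refine sum_congr rfl fun ω _ => ?_
      simp only [large, X, Y]
      ring
    have hfin : N * |∑ i ∈ S, ∑ j ∈ T, b i j * ∑ k, v i k * w j k| ≤ N * (49 * M + G / 2) := by
      rw [← abs_of_pos hNpos, ← abs_mul, abs_of_pos hNpos, hsplit]
      rw [abs_le] at hA hB hC ⊢
      constructor <;> linarith [hA.1, hA.2, hB.1, hB.2, hC.1, hC.2]
    exact le_of_mul_le_mul_left hfin hNpos
  have hinf : valid (sInf {G | valid G}) := fun ι _ v w hv hw =>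
    le_csInf ⟨_, hvalid0⟩ fun G hG => hG ι _ v w hv hw
  have hle : sInf {G | valid G} ≤ 49 * M + sInf {G | valid G} / 2 :=
    csInf_le ⟨0, fun G hG => hnonneg G hG⟩ (hstep _ hinf)
  have e := Fintype.equivFin ι
  have := hinf (Fin (Fintype.card ι)) inferInstance (fun i k => v i (e.symm k))
    (fun j k => w j (e.symm k)) (fun i => by rw [e.symm.sum_comp (fun k => v i k ^ 2)]; exact hv i)
    (fun j => by rw [e.symm.sum_comp (fun k => w j k ^ 2)]; exact hw j)
  have hsum : ∀ i j, ∑ k, v i (e.symm k) * w j (e.symm k) = ∑ k, v i k * w j k :=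
    fun i j => e.symm.sum_comp (fun k => v i k * w j k)
  simp only [hsum] at this
  linarith

namespace MeasureTheory.SimpleFunc

variable {Ω Ω₁ Ω₂ ι : Type*} [MeasurableSpace Ω] [MeasurableSpace Ω₁] [MeasurableSpace Ω₂]

theorem finset_sum_apply {κ : Type*} (s : Finset κ) (f : κ → SimpleFunc Ω ℝ) (ω : Ω) :
    (∑ k ∈ s, f k) ω = ∑ k ∈ s, f k ω := by
  classical
  induction s using Finset.induction_on with
  | empty => simp
  | insert a s ha ih => simp [Finset.sum_insert ha, ih]

/-- A finite family of simple functions, as a simple function into the product. -/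
def tuple [Finite ι] (x : ι → SimpleFunc Ω ℝ) : SimpleFunc Ω (ι → ℝ) where
  toFun ω i := x i ω
  measurableSet_fiber' v := by
    have : (fun ω i => x i ω) ⁻¹' {v} = ⋂ i, x i ⁻¹' {v i} := by
      ext ω; simp [funext_iff]
    rw [this]
    exact MeasurableSet.iInter fun i => (x i).measurableSet_fiber _
  finite_range' := by
    refine (Set.Finite.pi' fun i => (x i).finite_range).subset ?_
    rintro _ ⟨ω, rfl⟩ i
    exact ⟨ω, rfl⟩

@[simp] theorem tuple_apply [Finite ι] (x : ι → SimpleFunc Ω ℝ) (ω : Ω) (i : ι) :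
    tuple x ω i = x i ω := rfl

theorem map_eq_sum_range {γ : Type*} (F : SimpleFunc Ω γ) (g : γ → ℝ) :
    F.map g = ∑ v ∈ F.range, g v • F.map (Set.indicator {v} 1) := by
  ext ω
  classical
  rw [finset_sum_apply]
  simp [Pi.single_apply]

variable (B : (SimpleFunc Ω₁ ℝ) →ₗ[ℝ] (SimpleFunc Ω₂ ℝ) →ₗ[ℝ] ℝ)

theorem bilin_map_map {γ₁ γ₂ : Type*} (F : SimpleFunc Ω₁ γ₁) (G : SimpleFunc Ω₂ γ₂)
    (g : γ₁ → ℝ) (h : γ₂ → ℝ) :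
    B (F.map g) (G.map h) = ∑ v ∈ F.range, ∑ w ∈ G.range,
      B (F.map (Set.indicator {v} 1))
        (G.map (Set.indicator {w} 1)) * (g v * h w) := by
  rw [map_eq_sum_range F g, map_eq_sum_range G h]
  simp only [map_sum, map_smul, LinearMap.sum_apply, LinearMap.smul_apply, smul_eq_mul,
    Finset.mul_sum]
  rw [Finset.sum_comm]
  exact Finset.sum_congr rfl fun _ _ => Finset.sum_congr rfl fun _ _ => by ring

/-- The square-function form of Grothendieck's inequality, for bilinear forms on simple functions
bounded by a product of two monotone functionals of the squares. -/
theorem abs_sum_bilin_le [Fintype ι] (N₁ : (SimpleFunc Ω₁ ℝ) → ℝ) (N₂ : (SimpleFunc Ω₂ ℝ) → ℝ)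
    (hN₁ : Monotone N₁) (hN₂ : Monotone N₂)
    (hB : ∀ f g, |B f g| ≤ √(N₁ (f ^ 2)) * √(N₂ (g ^ 2)))
    (x : ι → SimpleFunc Ω₁ ℝ) (y : ι → SimpleFunc Ω₂ ℝ) :
    |∑ i, B (x i) (y i)| ≤ 98 * (√(N₁ (∑ i, x i ^ 2)) * √(N₂ (∑ i, y i ^ 2))) := by
  classical
  let nrm : (ι → ℝ) → ℝ := fun v => √(∑ i, v i ^ 2)
  have hnrm : ∀ v, nrm v ^ 2 = ∑ i, v i ^ 2 := fun v =>
    Real.sq_sqrt (Finset.sum_nonneg fun _ _ => sq_nonneg _)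
  have hunit : ∀ v : ι → ℝ, ∑ i, (v i / nrm v) ^ 2 ≤ 1 := fun v => by
    simp only [div_pow]
    rw [← Finset.sum_div, ← hnrm]
    exact div_self_le_one _
  have hmul : ∀ (v : ι → ℝ) (i : ι), nrm v * (v i / nrm v) = v i := fun v i => by
    rcases eq_or_ne (nrm v) 0 with h | h
    · have h0 := hnrm v
      rw [h, zero_pow two_ne_zero, eq_comm,
        Finset.sum_eq_zero_iff_of_nonneg fun _ _ => sq_nonneg _] at h0
      have : v i = 0 := by simpa using h0 i (Finset.mem_univ i)
      simp [this]
    · field_simp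
  have hmap : ∀ (v : ι → ℝ) (c : ℝ), |c| ≤ 1 → (nrm v * c) ^ 2 ≤ ∑ i, v i ^ 2 := by
    intro v c hc
    rw [mul_pow, hnrm]
    refine mul_le_of_le_one_right (Finset.sum_nonneg fun _ _ => sq_nonneg _) ?_
    rw [← sq_abs]
    exact pow_le_one₀ (abs_nonneg _) hc
  set F := tuple x
  set G := tuple y
  let b : (ι → ℝ) → (ι → ℝ) → ℝ := fun v w =>
    B (F.map (Set.indicator {v} 1))
      (G.map (Set.indicator {w} 1)) * (nrm v * nrm w)
  have key := grothendieck_inequality F.range G.range b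
    (√(N₁ (∑ i, x i ^ 2)) * √(N₂ (∑ i, y i ^ 2))) (fun ε δ hε hδ => ?_)
    (fun v i => v i / nrm v) (fun v i => v i / nrm v) hunit hunit
  · convert! key using 2
    simp only [b, Finset.mul_sum]
    calc ∑ i, B (x i) (y i) = ∑ i, B (F.map (fun v => v i)) (G.map (fun v => v i)) := rfl
      _ = _ := by
        rw [Finset.sum_congr rfl fun i _ => bilin_map_map B F G (fun v => v i) (fun v => v i),
          Finset.sum_comm]
        refine Finset.sum_congr rfl fun v _ => ?_
        rw [Finset.sum_comm]
        refine Finset.sum_congr rfl fun w _ => Finset.sum_congr rfl fun i _ => ?_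
        rw [mul_assoc, mul_mul_mul_comm, hmul, hmul]
  · have e : ∑ v ∈ F.range, ∑ w ∈ G.range, b v w * (ε v * δ w) =
        B (F.map fun v => nrm v * ε v) (G.map fun v => nrm v * δ v) := by
      rw [bilin_map_map]
      exact Finset.sum_congr rfl fun v _ => Finset.sum_congr rfl fun w _ => by
        simp only [b]; ring
    rw [e]
    refine (hB _ _).trans ?_
    gcongr
    · refine hN₁ fun ω => ?_
      rw [finset_sum_apply]
      exact hmap (F ω) _ (hε _)
    · refine hN₂ fun ω => ?_
      rw [finset_sum_apply]
      exact hmap (G ω) _ (hδ _)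

/-- Domination of a bilinear form on simple functions by a pair of linear functionals. -/
theorem exists_linear_dominating (N₁ : (SimpleFunc Ω₁ ℝ) → ℝ) (N₂ : (SimpleFunc Ω₂ ℝ) → ℝ)
    (hN₁ : Monotone N₁) (hN₂ : Monotone N₂)
    (hc₁ : ∀ c : ℝ, 0 < c → ∀ f, N₁ (c • f) = c * N₁ f)
    (hc₂ : ∀ c : ℝ, 0 < c → ∀ f, N₂ (c • f) = c * N₂ f)
    (ha₁ : ∀ f g, N₁ (f + g) ≤ N₁ f + N₁ g) (ha₂ : ∀ f g, N₂ (f + g) ≤ N₂ f + N₂ g)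
    (h0₁ : ∀ f, 0 ≤ N₁ f) (h0₂ : ∀ f, 0 ≤ N₂ f)
    (hB : ∀ f g, |B f g| ≤ √(N₁ (f ^ 2)) * √(N₂ (g ^ 2))) :
    ∃ (l₁ : (SimpleFunc Ω₁ ℝ) →ₗ[ℝ] ℝ) (l₂ : (SimpleFunc Ω₂ ℝ) →ₗ[ℝ] ℝ),
      (∀ f, l₁ f ≤ N₁ f) ∧ (∀ g, l₂ g ≤ N₂ g) ∧
      ∀ f g, |B f g| ≤ 98 * (√(l₁ (f ^ 2)) * √(l₂ (g ^ 2))) := by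
  let D : Set ((SimpleFunc Ω₁ ℝ) × (SimpleFunc Ω₂ ℝ) × ℝ) := {q | ∃ (ι : Type) (_ : Fintype ι)
    (x : ι → SimpleFunc Ω₁ ℝ) (y : ι → SimpleFunc Ω₂ ℝ),
      q = (∑ i, x i ^ 2, ∑ i, y i ^ 2, ∑ i, B (x i) (y i) / 49)}
  have hD : ∀ q ∈ D, q.2.2 ≤ N₁ q.1 + N₂ q.2.1 := by
    rintro _ ⟨ι, _, x, y, rfl⟩
    have h := (le_abs_self _).trans (abs_sum_bilin_le B N₁ N₂ hN₁ hN₂ hB x y)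
    simp only
    rw [← Finset.sum_div, div_le_iff₀ (by norm_num)]
    nlinarith [sq_nonneg (√(N₁ (∑ i, x i ^ 2)) - √(N₂ (∑ i, y i ^ 2))),
      Real.sq_sqrt (h0₁ (∑ i, x i ^ 2)), Real.sq_sqrt (h0₂ (∑ i, y i ^ 2))]
  have hDadd : ∀ q ∈ D, ∀ q' ∈ D, q + q' ∈ D := by
    rintro _ ⟨ι, _, x, y, rfl⟩ _ ⟨κ, _, x', y', rfl⟩
    exact ⟨ι ⊕ κ, inferInstance, Sum.elim x x', Sum.elim y y', by simp⟩
  have hDzero : (0 : (SimpleFunc Ω₁ ℝ) × (SimpleFunc Ω₂ ℝ) × ℝ) ∈ D :=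
    ⟨Empty, inferInstance, Empty.elim, Empty.elim, by simp; rfl⟩
  have hDsmul : ∀ c : ℝ, 0 < c → ∀ q ∈ D, c • q ∈ D := by
    rintro c hc _ ⟨ι, _, x, y, rfl⟩
    refine ⟨ι, inferInstance, fun i => √c • x i, fun i => √c • y i, ?_⟩
    have hs : √c * √c = c := Real.mul_self_sqrt hc.le
    simp only [smul_pow, Real.sq_sqrt hc.le, map_smul, LinearMap.smul_apply,
      Prod.smul_mk, Finset.smul_sum, smul_eq_mul, mul_div_assoc, ← mul_assoc √c, hs,
      Finset.mul_sum]
  let Φ : (SimpleFunc Ω₁ ℝ) × (SimpleFunc Ω₂ ℝ) → (SimpleFunc Ω₁ ℝ) × (SimpleFunc Ω₂ ℝ) × ℝ → ℝ :=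
    fun z q => N₁ (z.1 + q.1) + N₂ (z.2 + q.2.1) - q.2.2
  have hbdd : ∀ z, BddBelow (Set.range fun q : D => Φ z q) := by
    intro z
    refine ⟨-(N₁ (-z.1) + N₂ (-z.2)), ?_⟩
    rintro _ ⟨⟨q, hq⟩, rfl⟩
    have h1 := ha₁ (z.1 + q.1) (-z.1)
    have h2 := ha₂ (z.2 + q.2.1) (-z.2)
    rw [add_neg_cancel_comm] at h1 h2
    have := hD q hq
    simp only [Φ]
    linarith
  have : Nonempty D := ⟨⟨0, hDzero⟩⟩
  let P : (SimpleFunc Ω₁ ℝ) × (SimpleFunc Ω₂ ℝ) → ℝ := fun z => ⨅ q : D, Φ z q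
  have hP : ∀ z, ∀ q ∈ D, P z ≤ Φ z q := fun z q hq => ciInf_le (hbdd z) ⟨q, hq⟩
  have hPsmul_le : ∀ c : ℝ, 0 < c → ∀ z, P (c • z) ≤ c * P z := by
    intro c hc z
    rw [Real.mul_iInf_of_nonneg hc.le]
    refine le_ciInf fun ⟨q, hq⟩ => (hP _ _ (hDsmul c hc q hq)).trans_eq ?_
    simp only [Φ, Prod.smul_fst, Prod.smul_snd, ← smul_add, hc₁ c hc, hc₂ c hc, smul_eq_mul]
    ring
  have hP0 : P 0 = 0 := by
    have h1 : P 0 ≤ 0 := by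
      have hz₁ := hc₁ 2 two_pos 0
      have hz₂ := hc₂ 2 two_pos 0
      rw [smul_zero] at hz₁ hz₂
      refine (hP 0 0 hDzero).trans ?_
      simp only [Φ, Prod.fst_zero, Prod.snd_zero, add_zero]
      linarith
    refine le_antisymm h1 (le_ciInf fun ⟨q, hq⟩ => ?_)
    have := hD q hq
    simp only [Φ, Prod.fst_zero, Prod.snd_zero, zero_add]
    linarith
  obtain ⟨l, -, hl⟩ := exists_extension_of_le_sublinear
    (⟨⊥, 0⟩ : ((SimpleFunc Ω₁ ℝ) × (SimpleFunc Ω₂ ℝ)) →ₗ.[ℝ] ℝ) P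
    (fun c hc z => le_antisymm (hPsmul_le c hc z) (by
      have := hPsmul_le c⁻¹ (inv_pos.2 hc) (c • z)
      rwa [inv_smul_smul₀ hc.ne', le_inv_mul_iff₀ hc] at this))
    (fun z z' => by
      refine le_ciInf_add_ciInf fun ⟨q, hq⟩ ⟨q', hq'⟩ =>
        (hP _ _ (hDadd q hq q' hq')).trans ?_
      have h1 := ha₁ (z.1 + q.1) (z'.1 + q'.1)
      have h2 := ha₂ (z.2 + q.2.1) (z'.2 + q'.2.1)
      simp only [Φ, Prod.fst_add, Prod.snd_add]
      rw [add_add_add_comm] at h1 h2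
      linarith)
    (by
      rintro ⟨x, hx⟩
      obtain rfl : x = 0 := by simpa using hx
      simp [hP0])
  have hzero₁ : N₁ 0 = 0 := by
    have := hc₁ 2 two_pos 0
    rw [smul_zero] at this
    linarith
  have hzero₂ : N₂ 0 = 0 := by
    have := hc₂ 2 two_pos 0
    rw [smul_zero] at this
    linarith
  have hle : ∀ z, l z ≤ N₁ z.1 + N₂ z.2 := fun z => by
    simpa [Φ] using (hl z).trans (hP z 0 hDzero)
  have hpos : ∀ f g, B f g / 49 ≤ l (f ^ 2, 0) + l (0, g ^ 2) := by
    intro f g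
    have h := (hl (-(f ^ 2, g ^ 2))).trans (hP _ (f ^ 2, g ^ 2, B f g / 49)
      ⟨Unit, inferInstance, fun _ => f, fun _ => g, by simp⟩)
    rw [map_neg] at h
    simp only [Φ, Prod.fst_neg, Prod.snd_neg, neg_add_cancel, hzero₁, hzero₂] at h
    have e : l (f ^ 2, 0) + l (0, g ^ 2) = l (f ^ 2, g ^ 2) := by
      rw [← l.map_add, Prod.mk_add_mk, add_zero, zero_add]
    linarith
  refine ⟨l ∘ₗ LinearMap.inl ℝ _ _, l ∘ₗ LinearMap.inr ℝ _ _, fun f => ?_, fun g => ?_,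
    fun f g => ?_⟩
  · simpa [hzero₂] using hle (f, 0)
  · simpa [hzero₁] using hle (0, g)
  · simp only [LinearMap.comp_apply, LinearMap.inl_apply, LinearMap.inr_apply]
    have hl00 : l (0, 0) = 0 := l.map_zero
    have hA : 0 ≤ l (f ^ 2, 0) := by simpa [hl00] using hpos f 0
    have hB' : 0 ≤ l (0, g ^ 2) := by simpa [hl00] using hpos 0 g
    have hd := discrim_le_zero (a := l (f ^ 2, 0)) (b := -(B f g / 49)) (c := l (0, g ^ 2))
      fun c => by
        have h := hpos (c • f) g
        have e : ((c • f) ^ 2, (0 : SimpleFunc Ω₂ ℝ)) =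
            (c * c) • (f ^ 2, (0 : SimpleFunc Ω₂ ℝ)) := by
          rw [smul_pow, Prod.smul_mk, smul_zero, sq c]
        rw [e, map_smul, map_smul, LinearMap.smul_apply, smul_eq_mul, smul_eq_mul] at h
        linarith
    rw [discrim] at hd
    refine abs_le_of_sq_le_sq ?_ (by positivity)
    rw [mul_pow, mul_pow, Real.sq_sqrt hA, Real.sq_sqrt hB']
    linarith

end MeasureTheory.SimpleFunc

section Representation

open Filter Topology

variable {Ω : Type*} [MeasurableSpace Ω]

theorem restrict_union_of_disjoint {A B : Set Ω} (hA : MeasurableSet A) (hB : MeasurableSet B)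
    (h : Disjoint A B) (f : SimpleFunc Ω ℝ) : f.restrict (A ∪ B) = f.restrict A + f.restrict B := by
  apply SimpleFunc.coe_injective
  rw [SimpleFunc.coe_add, SimpleFunc.coe_restrict _ hA, SimpleFunc.coe_restrict _ hB,
    SimpleFunc.coe_restrict _ (hA.union hB),
    Set.indicator_union_of_disjoint h]
  rfl

/-- A linear functional on simple functions dominated by the `L^p` norm of the positive part is
given by a nonnegative density in the unit ball of the dual space. -/
theorem exists_density_of_le_eLpNorm (m : Measure Ω) [IsFiniteMeasure m] {p : ℝ} (hp : 1 ≤ p)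
    (l : (SimpleFunc Ω ℝ) →ₗ[ℝ] ℝ)
    (hl : ∀ f, l f ≤ (eLpNorm (fun ω => max (f ω) 0) (ENNReal.ofReal p) m).toReal) :
    ∃ φ : Ω → ℝ, Measurable φ ∧ (∀ ω, 0 ≤ φ ω) ∧
      (∀ f : SimpleFunc Ω ℝ, 0 ≤ f → ENNReal.ofReal (l f) = ∫⁻ ω, ENNReal.ofReal (f ω * φ ω) ∂m) ∧
      (p = 1 → ∀ᵐ ω ∂m, φ ω ≤ 1) ∧
      (1 < p → ∫⁻ ω, ENNReal.ofReal (φ ω) ^ (p / (p - 1)) ∂m ≤ 1) := by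
  have hp0 : 0 < p := one_pos.trans_le hp
  have hpE : ENNReal.ofReal p ≠ 0 := by simpa using hp0
  have hpos : ∀ f : SimpleFunc Ω ℝ, 0 ≤ f → 0 ≤ l f := by
    intro f hf
    have h := hl (-f)
    have e : (fun ω => max ((-f) ω) 0) = 0 := by
      ext ω
      simpa using hf ω
    rw [e, eLpNorm_zero, ENNReal.toReal_zero, map_neg] at h
    linarith
  let I : Set Ω → SimpleFunc Ω ℝ := fun A => (1 : SimpleFunc Ω ℝ).restrict A
  have hI : ∀ {A}, MeasurableSet A → ⇑(I A) = A.indicator 1 := fun hA =>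
    SimpleFunc.coe_restrict _ hA
  have hIpos : ∀ {A}, MeasurableSet A → 0 ≤ l (I A) := fun {A} hA => hpos _ fun ω => by
    rw [hI hA]
    exact Set.indicator_nonneg (fun _ _ => zero_le_one) ω
  have hIle : ∀ {A}, MeasurableSet A → ENNReal.ofReal (l (I A)) ≤ m A ^ (1 / p) := by
    intro A hA
    refine (ENNReal.ofReal_le_ofReal (hl _)).trans (ENNReal.ofReal_toReal_le.trans_eq ?_)
    have e : (fun ω => max (I A ω) 0) = A.indicator (fun _ => (1 : ℝ)) := by
      ext ω
      rw [hI hA]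
      by_cases h : ω ∈ A <;> simp [h]
    rw [e, eLpNorm_indicator_const hA hpE ofReal_ne_top, ENNReal.toReal_ofReal hp0.le]
    simp
  have htail : ∀ (A : ℕ → Set Ω), (∀ i, MeasurableSet (A i)) →
      Pairwise (Function.onFun Disjoint A) →
      ∀ n, l (I (⋃ i, A i)) = ∑ i ∈ Finset.range n, l (I (A i)) + l (I (⋃ i ≥ n, A i)) := by
    intro A hA hd n
    induction n with
    | zero => simp
    | succ n ih =>
      have e : ⋃ i ≥ n, A i = A n ∪ ⋃ i ≥ n + 1, A i := by
        ext ω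
        simp only [Set.mem_iUnion, Set.mem_union, exists_prop]
        constructor
        · rintro ⟨i, hi, h⟩
          rcases hi.eq_or_lt with rfl | hi
          · exact Or.inl h
          · exact Or.inr ⟨i, hi, h⟩
        · rintro (h | ⟨i, hi, h⟩)
          · exact ⟨n, le_rfl, h⟩
          · exact ⟨i, (Nat.le_succ n).trans hi, h⟩
      have hdis : Disjoint (A n) (⋃ i ≥ n + 1, A i) := by
        simp only [Set.disjoint_iUnion_right]
        exact fun i hi => hd (by omega)
      rw [ih, e, Finset.sum_range_succ]
      simp only [I]
      rw [restrict_union_of_disjoint (hA n)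
        (MeasurableSet.iUnion fun i => MeasurableSet.iUnion fun _ => hA i) hdis, map_add]
      ring
  let lam : Measure Ω := Measure.ofMeasurable (fun A _ => ENNReal.ofReal (l (I A)))
    (by simp [I]) (by
      intro A hA hd
      have hs : HasSum (fun i => l (I (A i))) (l (I (⋃ i, A i))) := by
        rw [hasSum_iff_tendsto_nat_of_nonneg fun i => hIpos (hA i)]
        have hm := tendsto_measure_biUnion_Ici_zero_of_pairwise_disjoint (μ := m)
          (fun i => (hA i).nullMeasurableSet) hd
        have hm' : Tendsto (fun n => m (⋃ i ≥ n, A i) ^ (1 / p)) atTop (𝓝 0) := by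
          have := (ENNReal.continuous_rpow_const (y := 1 / p)).tendsto 0 |>.comp hm
          rwa [ENNReal.zero_rpow_of_pos (by positivity)] at this
        have hM : ∀ n, MeasurableSet (⋃ i ≥ n, A i) := fun n =>
          MeasurableSet.iUnion fun i => MeasurableSet.iUnion fun _ => hA i
        have h0 : Tendsto (fun n => ENNReal.ofReal (l (I (⋃ i ≥ n, A i)))) atTop (𝓝 0) :=
          tendsto_of_tendsto_of_tendsto_of_le_of_le tendsto_const_nhds hm'
            (fun _ => zero_le) fun n => hIle (hM n)
        have h1 := (ENNReal.tendsto_toReal ENNReal.zero_ne_top).comp h0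
        have h2 : Tendsto (fun n => l (I (⋃ i, A i)) - l (I (⋃ i ≥ n, A i))) atTop
            (𝓝 (l (I (⋃ i, A i)) - 0)) := by
          refine tendsto_const_nhds.sub (h1.congr fun n => ?_)
          exact ENNReal.toReal_ofReal (hIpos (hM n))
        rw [sub_zero] at h2
        refine h2.congr fun n => ?_
        rw [htail A hA hd n]
        ring
      rw [← hs.tsum_eq, ENNReal.ofReal_tsum_of_nonneg (fun i => hIpos (hA i)) hs.summable])
  have hlam : ∀ {A}, MeasurableSet A → lam A = ENNReal.ofReal (l (I A)) := fun hA =>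
    Measure.ofMeasurable_apply _ hA
  have : IsFiniteMeasure lam := ⟨by rw [hlam .univ]; exact ofReal_lt_top⟩
  have hac : lam ≪ m := Measure.AbsolutelyContinuous.mk fun A hA h0 => by
    have := hIle hA
    rw [h0, ENNReal.zero_rpow_of_pos (by positivity)] at this
    rw [hlam hA]
    exact le_antisymm this (zero_le)
  have hl_integral : ∀ f : SimpleFunc Ω ℝ, l f = ∫ ω, f ω ∂lam := by
    intro f
    induction f using SimpleFunc.induction with
    | @const c s hs =>
      have e : SimpleFunc.piecewise s hs (SimpleFunc.const Ω c) (SimpleFunc.const Ω 0) =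
          c • I s := by
        apply SimpleFunc.coe_injective
        rw [SimpleFunc.coe_smul, hI hs]
        ext ω
        by_cases h : ω ∈ s <;> simp [h]
      rw [e, map_smul, SimpleFunc.coe_smul, hI hs]
      simp only [Pi.smul_apply, smul_eq_mul, integral_const_mul, integral_indicator_one hs]
      rw [measureReal_def, hlam hs, ENNReal.toReal_ofReal (hIpos hs)]
    | @add f g _ hf hg =>
      rw [map_add, hf, hg, ← integral_add (f.integrable_of_isFiniteMeasure)
        (g.integrable_of_isFiniteMeasure)]
      rfl
  set D := lam.rnDeriv m with hD
  have hDae : ∀ᵐ ω ∂m, ENNReal.ofReal (D ω).toReal = D ω := by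
    filter_upwards [lam.rnDeriv_ne_top m] with ω h using ENNReal.ofReal_toReal h
  have hrep : ∀ f : SimpleFunc Ω ℝ, 0 ≤ f →
      ENNReal.ofReal (l f) = ∫⁻ ω, ENNReal.ofReal (f ω * (D ω).toReal) ∂m := by
    intro f hf
    rw [hl_integral, ofReal_integral_eq_lintegral_ofReal f.integrable_of_isFiniteMeasure
      (ae_of_all _ hf), ← lintegral_rnDeriv_mul hac f.measurable.ennreal_ofReal.aemeasurable]
    refine lintegral_congr_ae ?_
    filter_upwards [hDae] with ω h
    rw [ENNReal.ofReal_mul (hf ω), h, mul_comm]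
  refine ⟨fun ω => (D ω).toReal, (lam.measurable_rnDeriv m).ennreal_toReal,
    fun ω => ENNReal.toReal_nonneg, hrep, ?_, ?_⟩
  · rintro rfl
    have hle : lam ≤ m := Measure.le_iff.2 fun A hA => by
      rw [hlam hA]
      simpa using hIle hA
    filter_upwards [Measure.rnDeriv_le_one_of_le hle] with ω h
    exact ENNReal.toReal_le_of_le_ofReal zero_le_one (by simpa using h)
  · intro hp1
    have hq : 1 / p + 1 / (p / (p - 1)) = 1 := by
      have : p - 1 ≠ 0 := by linarith
      field_simp
      ring
    have hq0 : 0 < p / (p - 1) := div_pos hp0 (by linarith)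
    rw [lintegral_eq_nnreal]
    refine iSup₂_le fun k hk => ?_
    set J := (k.map ((↑) : ℝ≥0 → ℝ≥0∞)).lintegral m with hJ
    have hJint : J = ∫⁻ ω, (k ω : ℝ≥0∞) ∂m := by
      rw [hJ, ← SimpleFunc.lintegral_eq_lintegral]
      rfl
    have hJtop : J ≠ ∞ := by
      rw [hJint]
      obtain ⟨C, hC⟩ := k.exists_forall_le
      refine ((lintegral_mono fun ω => ENNReal.coe_le_coe.2 (hC ω)).trans_lt ?_).ne
      rw [lintegral_const]
      exact ENNReal.mul_lt_top coe_lt_top (measure_lt_top _ _)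
    let f : SimpleFunc Ω ℝ := SimpleFunc.map (fun z : ℝ≥0 => (z : ℝ) ^ (1 / p)) k
    have hf : ∀ ω, f ω = (k ω : ℝ) ^ (1 / p) := fun ω => rfl
    have hf0 : 0 ≤ f := fun ω => Real.rpow_nonneg (k ω).coe_nonneg _
    have hf0' : ∀ ω, (0 : ℝ) ≤ f ω := hf0
    have hup : ENNReal.ofReal (l f) ≤ J ^ (1 / p) := by
      refine (ENNReal.ofReal_le_ofReal (hl _)).trans (ENNReal.ofReal_toReal_le.trans_eq ?_)
      rw [eLpNorm_eq_lintegral_rpow_enorm_toReal hpE ofReal_ne_top, ENNReal.toReal_ofReal hp0.le,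
        hJint]
      congr 2
      ext ω
      rw [max_eq_left (hf0' ω), Real.enorm_of_nonneg (hf0' ω),
        ENNReal.ofReal_rpow_of_nonneg (hf0' ω) hp0.le, hf, ← Real.rpow_mul (k ω).coe_nonneg,
        one_div_mul_cancel hp0.ne', Real.rpow_one, ENNReal.ofReal_coe_nnreal]
    have hdown : J ≤ ENNReal.ofReal (l f) := by
      rw [hrep f hf0, hJint]
      refine lintegral_mono fun ω => ?_
      have h1 : (k ω : ℝ≥0∞) ^ (1 / (p / (p - 1))) ≤ ENNReal.ofReal (D ω).toReal := by
        rw [one_div, ENNReal.rpow_inv_le_iff hq0]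
        exact hk ω
      calc (k ω : ℝ≥0∞) = (k ω : ℝ≥0∞) ^ (1 / p) * (k ω : ℝ≥0∞) ^ (1 / (p / (p - 1))) := by
            rw [← ENNReal.rpow_add_of_nonneg _ _ (by positivity) (by positivity), hq,
              ENNReal.rpow_one]
        _ ≤ (k ω : ℝ≥0∞) ^ (1 / p) * ENNReal.ofReal (D ω).toReal := by gcongr
        _ = _ := by
            rw [ENNReal.ofReal_mul (hf0' ω), hf, ← ENNReal.ofReal_rpow_of_nonneg (k ω).coe_nonneg
              (by positivity), ENNReal.ofReal_coe_nnreal]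
    by_contra! h
    have := ENNReal.rpow_lt_rpow_of_exponent_lt h hJtop (show 1 / p < 1 by
      rwa [div_lt_one hp0])
    rw [ENNReal.rpow_one] at this
    exact (hdown.trans hup).not_gt this

end Representation

section Weighted

open Filter Topology

variable {Ω : Type*} [MeasurableSpace Ω]

theorem eLpNorm_mul_rpow_eq_withDensity (μ : Measure Ω) {W : Ω → ℝ≥0} (hW : Measurable W) {s : ℝ}
    (hs : 0 < s) (f : Ω → ℝ) :
    eLpNorm (fun ω => f ω * (W ω : ℝ) ^ (1 / s)) (ENNReal.ofReal s) μ =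
      eLpNorm f (ENNReal.ofReal s) (μ.withDensity fun ω => (W ω : ℝ≥0∞)) := by
  have hs0 : ENNReal.ofReal s ≠ 0 := by simpa using hs
  rw [eLpNorm_eq_lintegral_rpow_enorm_toReal hs0 ofReal_ne_top,
    eLpNorm_eq_lintegral_rpow_enorm_toReal hs0 ofReal_ne_top, ENNReal.toReal_ofReal hs.le,
    lintegral_withDensity_eq_lintegral_mul_non_measurable₀ μ hW.coe_nnreal_ennreal.aemeasurable
      (ae_of_all _ fun _ => coe_lt_top)]
  congr 2
  ext ω
  have h0 : (0 : ℝ) ≤ (W ω : ℝ) ^ (1 / s) := Real.rpow_nonneg (W ω).coe_nonneg _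
  rw [Pi.mul_apply, enorm_mul, ENNReal.mul_rpow_of_nonneg _ _ hs.le, Real.enorm_of_nonneg h0,
    ENNReal.ofReal_rpow_of_nonneg h0 hs.le, ← Real.rpow_mul (W ω).coe_nonneg,
    one_div_mul_cancel hs.ne', Real.rpow_one, ENNReal.ofReal_coe_nnreal, mul_comm]

/-- The `L^p` norm of the positive part, as a sublinear functional on simple functions. -/
theorem eLpNorm_posPart_sublinear (m : Measure Ω) [IsFiniteMeasure m] {p : ℝ} (hp : 1 ≤ p)
    {N : (SimpleFunc Ω ℝ) → ℝ}
    (hN : ∀ f, N f = (eLpNorm (fun ω => max (f ω) 0) (ENNReal.ofReal p) m).toReal) :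
    Monotone N ∧ (∀ c : ℝ, 0 < c → ∀ f, N (c • f) = c * N f) ∧
      (∀ f g, N (f + g) ≤ N f + N g) ∧ ∀ f, 0 ≤ N f := by
  have hmem : ∀ f : SimpleFunc Ω ℝ, MemLp (fun ω => max (f ω) 0) (ENNReal.ofReal p) m := fun f =>
    (SimpleFunc.map (fun z : ℝ => max z 0) f).memLp_of_isFiniteMeasure _ _
  refine ⟨fun f g hfg => ?_, fun c hc f => ?_, fun f g => ?_, fun f => ?_⟩
  · rw [hN, hN]
    refine ENNReal.toReal_mono (hmem g).2.ne (eLpNorm_mono_real fun ω => ?_)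
    rw [Real.norm_of_nonneg (le_max_right _ _)]
    exact max_le_max (hfg ω) le_rfl
  · have e : (fun ω => max ((c • f) ω) 0) = c • fun ω => max (f ω) 0 := by
      ext ω
      simp [mul_max_of_nonneg _ _ hc.le]
    rw [hN, hN, e, eLpNorm_const_smul, ENNReal.toReal_mul, toReal_enorm,
      Real.norm_of_nonneg hc.le]
  · rw [hN, hN, hN, ← ENNReal.toReal_add (hmem f).2.ne (hmem g).2.ne]
    refine ENNReal.toReal_mono (ENNReal.add_ne_top.2 ⟨(hmem f).2.ne, (hmem g).2.ne⟩) ?_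
    refine le_trans (eLpNorm_mono_real (g := (fun ω => max (f ω) 0) + fun ω => max (g ω) 0)
      fun ω => ?_) (eLpNorm_add_le (hmem f).1 (hmem g).1 (by simpa using hp))
    rw [Real.norm_of_nonneg (le_max_right _ _)]
    refine max_le (add_le_add (le_max_left _ _) (le_max_left _ _)) ?_
    exact add_nonneg (le_max_right _ _) (le_max_right _ _)
  · rw [hN]
    exact ENNReal.toReal_nonneg

/-- On a σ-finite space, `L^s` contains a dense copy of a space of simple functions whose norm is
controlled by a sublinear functional `N`; every linear functional below `N` is dominated by
integration against a weight in the unit ball of `L^{(s/2)'}`. -/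
theorem exists_simpleFunc_embedding (μ : Measure Ω) [SigmaFinite μ] {s : ℝ} (hs : 2 ≤ s)
    [Fact (1 ≤ ENNReal.ofReal s)] :
    ∃ (N : (SimpleFunc Ω ℝ) → ℝ) (T : (SimpleFunc Ω ℝ) →ₗ[ℝ] Lp ℝ (ENNReal.ofReal s) μ) (s' : ℝ≥0∞),
      (Monotone N ∧ (∀ c : ℝ, 0 < c → ∀ f, N (c • f) = c * N f) ∧
        (∀ f g, N (f + g) ≤ N f + N g) ∧ ∀ f, 0 ≤ N f) ∧
      (∀ f, ‖T f‖ = √(N (f ^ 2))) ∧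
      1 / ENNReal.ofReal (s / 2) + 1 / s' = 1 ∧
      ∀ l : (SimpleFunc Ω ℝ) →ₗ[ℝ] ℝ, (∀ f, l f ≤ N f) →
        ∃ φ : Ω → ℝ, Measurable φ ∧ (∀ ω, 0 ≤ φ ω) ∧ eLpNorm φ s' μ ≤ 1 ∧
          ∀ x : Lp ℝ (ENNReal.ofReal s) μ, ∃ f : ℕ → SimpleFunc Ω ℝ,
            Tendsto (fun n => T (f n)) atTop (𝓝 x) ∧
            ∀ n, ENNReal.ofReal (l (f n ^ 2)) ≤ 4 * ∫⁻ ω, ENNReal.ofReal (x ω ^ 2 * φ ω) ∂μ := by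
  have hs0 : 0 < s := by linarith
  obtain ⟨W, hWpos, hW, hWint⟩ := exists_pos_lintegral_lt_of_sigmaFinite μ one_ne_zero
  have hWE : Measurable fun ω => (W ω : ℝ≥0∞) := hW.coe_nnreal_ennreal
  set m := μ.withDensity fun ω => (W ω : ℝ≥0∞) with hm
  have : IsFiniteMeasure m := isFiniteMeasure_withDensity (hWint.trans one_lt_top).ne
  let w : Ω → ℝ := fun ω => (W ω : ℝ) ^ (1 / s)
  have hwpos : ∀ ω, 0 < w ω := fun ω => Real.rpow_pos_of_pos (NNReal.coe_pos.2 (hWpos ω)) _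
  have hwm : Measurable w := hW.coe_nnreal_real.pow_const _
  have hnorm : ∀ f : Ω → ℝ, eLpNorm (f * w) (ENNReal.ofReal s) μ =
      eLpNorm f (ENNReal.ofReal s) m := eLpNorm_mul_rpow_eq_withDensity μ hW hs0
  have hmem : ∀ f : SimpleFunc Ω ℝ, MemLp (⇑f * w) (ENNReal.ofReal s) μ := fun f =>
    ⟨(f.measurable.mul hwm).aestronglyMeasurable, by
      rw [hnorm]
      exact (f.memLp_of_isFiniteMeasure _ _).2⟩
  let N : (SimpleFunc Ω ℝ) → ℝ := fun f =>
    (eLpNorm (fun ω => max (f ω) 0) (ENNReal.ofReal (s / 2)) m).toReal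
  let T : (SimpleFunc Ω ℝ) →ₗ[ℝ] Lp ℝ (ENNReal.ofReal s) μ :=
    { toFun := fun f => (hmem f).toLp _
      map_add' := fun f g => by
        rw [← MemLp.toLp_add]
        exact MemLp.toLp_congr _ _ (ae_of_all _ fun ω => by simp [add_mul])
      map_smul' := fun c f => by
        rw [RingHom.id_apply, ← MemLp.toLp_const_smul]
        exact MemLp.toLp_congr _ _ (ae_of_all _ fun ω => by simp [mul_assoc]) }
  have hTN : ∀ f, ‖T f‖ = √(N (f ^ 2)) := by
    intro f
    have e : (fun ω => max ((f ^ 2) ω) 0) = fun ω => ‖f ω‖ ^ (2 : ℝ) := by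
      ext ω
      simp [sq_nonneg]
    have e2 : ENNReal.ofReal (s / 2) * ENNReal.ofReal 2 = ENNReal.ofReal s := by
      rw [← ENNReal.ofReal_mul (by positivity)]
      congr 1
      ring
    change ‖(hmem f).toLp _‖ = √((eLpNorm (fun ω => max ((f ^ 2) ω) 0) _ m).toReal)
    rw [Lp.norm_toLp, hnorm, e, eLpNorm_norm_rpow _ two_pos, e2, ← ENNReal.toReal_rpow]
    norm_cast
    exact (Real.sqrt_sq ENNReal.toReal_nonneg).symm
  have happrox : ∀ (l : (SimpleFunc Ω ℝ) →ₗ[ℝ] ℝ) (φ : Ω → ℝ), (∀ ω, 0 ≤ φ ω) →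
      (∀ f : SimpleFunc Ω ℝ, 0 ≤ f → ENNReal.ofReal (l f) = ∫⁻ ω, ENNReal.ofReal (f ω * φ ω) ∂m) →
      ∀ x : Lp ℝ (ENNReal.ofReal s) μ, ∃ f : ℕ → SimpleFunc Ω ℝ,
        Tendsto (fun n => T (f n)) atTop (𝓝 x) ∧
        ∀ n, ENNReal.ofReal (l (f n ^ 2)) ≤
          4 * ∫⁻ ω, ENNReal.ofReal (x ω ^ 2 * (φ ω * (W ω : ℝ) ^ (1 - 2 / s))) ∂μ := by
    intro l φ hφ hl x
    let h : Ω → ℝ := fun ω => x ω / w ω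
    have hh : Measurable h := (Lp.stronglyMeasurable x).measurable.div hwm
    have hhw : h * w = x := by
      ext ω
      exact div_mul_cancel₀ _ (hwpos ω).ne'
    let f : ℕ → SimpleFunc Ω ℝ := fun n => SimpleFunc.approxOn h hh Set.univ 0 (Set.mem_univ 0) n
    refine ⟨f, ?_, fun n => ?_⟩
    · have key : Tendsto (fun n => eLpNorm (⇑(f n) - h) (ENNReal.ofReal s) m) atTop (𝓝 0) := by
        refine SimpleFunc.tendsto_approxOn_Lp_eLpNorm hh (Set.mem_univ 0) ofReal_ne_top
          (ae_of_all _ fun ω => by simp) ?_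
        simp only [sub_zero]
        rw [← hnorm, hhw]
        exact (Lp.memLp x).2
      have hx : x = (Lp.memLp x).toLp x := (Lp.toLp_coeFn x _).symm
      rw [hx]
      refine (Lp.tendsto_Lp_iff_tendsto_eLpNorm'' (fun n => ⇑(f n) * w) (fun n => hmem (f n)) x
        (Lp.memLp x)).2 (key.congr fun n => ?_)
      rw [← hnorm, sub_mul, hhw]
    · rw [hl _ fun ω => by simpa using sq_nonneg (f n ω), hm,
        lintegral_withDensity_eq_lintegral_mul_non_measurable₀ μ hWE.aemeasurable
          (ae_of_all _ fun _ => coe_lt_top), ← lintegral_const_mul' _ _ (by simp)]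
      refine lintegral_mono fun ω => ?_
      have hWω : (0 : ℝ) < W ω := NNReal.coe_pos.2 (hWpos ω)
      have h1 : |f n ω| ≤ 2 * |h ω| := by
        have := SimpleFunc.norm_approxOn_zero_le hh (Set.mem_univ 0) ω n
        rw [two_mul]
        exact this
      have h2 : (f n ω) ^ 2 ≤ 4 * h ω ^ 2 := by
        rw [← sq_abs, ← sq_abs (h ω)]
        nlinarith [abs_nonneg (f n ω), abs_nonneg (h ω)]
      have h3 : (W ω : ℝ) * h ω ^ 2 = x ω ^ 2 * (W ω : ℝ) ^ (1 - 2 / s) := by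
        have : w ω ^ 2 = (W ω : ℝ) ^ (2 / s) := by
          rw [← Real.rpow_natCast, ← Real.rpow_mul hWω.le]
          congr 1
          push_cast
          ring
        rw [Real.rpow_sub hWω, Real.rpow_one, ← this]
        simp only [h]
        ring
      rw [Pi.mul_apply, ← ENNReal.ofReal_coe_nnreal, ← ENNReal.ofReal_mul hWω.le,
        show (4 : ℝ≥0∞) = ENNReal.ofReal 4 by simp, ← ENNReal.ofReal_mul (by norm_num)]
      refine ENNReal.ofReal_le_ofReal ?_
      calc (W ω : ℝ) * ((f n ^ 2) ω * φ ω) = W ω * (f n ω) ^ 2 * φ ω := by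
            simp only [SimpleFunc.coe_pow, Pi.pow_apply]
            ring
        _ ≤ W ω * (4 * h ω ^ 2) * φ ω := by
            have := hφ ω
            gcongr
        _ = _ := by
            linear_combination 4 * φ ω * h3
  obtain rfl | hs2 := hs.eq_or_lt
  · refine ⟨N, T, ∞, eLpNorm_posPart_sublinear m (p := 2 / 2) (by norm_num) fun _ => rfl, hTN,
      by simp, fun l hl => ?_⟩
    obtain ⟨φ, hφm, hφ, hrep, hle, -⟩ :=
      exists_density_of_le_eLpNorm m (p := 2 / 2) (by norm_num) l hl
    refine ⟨φ, hφm, hφ, ?_, fun x => ?_⟩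
    · have hac : μ ≪ m := withDensity_absolutelyContinuous' hWE.aemeasurable
        (ae_of_all _ fun ω => by simpa using (hWpos ω).ne')
      rw [eLpNorm_exponent_top]
      refine eLpNormEssSup_le_of_ae_bound (C := 1) ?_ |>.trans_eq ENNReal.ofReal_one
      filter_upwards [hac.ae_le (hle (by norm_num))] with ω h
      rwa [Real.norm_of_nonneg (hφ ω)]
    · simpa using happrox l φ hφ hrep x
  · have hp1 : 1 < s / 2 := by linarith
    have hq0 : 0 < s / (s - 2) := div_pos hs0 (by linarith)
    have hs2' : s - 2 ≠ 0 := by linarith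
    have hq : s / 2 / (s / 2 - 1) = s / (s - 2) := by
      have : s / 2 - 1 ≠ 0 := by linarith
      field_simp
    refine ⟨N, T, ENNReal.ofReal (s / (s - 2)), eLpNorm_posPart_sublinear m hp1.le fun _ => rfl,
      hTN, ?_, fun l hl => ?_⟩
    · rw [one_div, one_div, ← ENNReal.ofReal_inv_of_pos (by positivity),
        ← ENNReal.ofReal_inv_of_pos hq0, ← ENNReal.ofReal_add (by positivity) (by positivity),
        ← ENNReal.ofReal_one]
      congr 1
      field_simp
      ring
    obtain ⟨φ, hφm, hφ, hrep, -, hle⟩ := exists_density_of_le_eLpNorm m hp1.le l hl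
    refine ⟨fun ω => φ ω * (W ω : ℝ) ^ (1 - 2 / s), hφm.mul (hW.coe_nnreal_real.pow_const _),
      fun ω => mul_nonneg (hφ ω) (Real.rpow_nonneg (W ω).coe_nonneg _), ?_,
      happrox l φ hφ hrep⟩
    have hexp : 1 - 2 / s = 1 / (s / (s - 2)) := by
      field_simp
    rw [hexp, eLpNorm_mul_rpow_eq_withDensity μ hW hq0,
      eLpNorm_eq_lintegral_rpow_enorm_toReal (by simpa using hq0) ofReal_ne_top,
      ENNReal.toReal_ofReal hq0.le]
    refine ENNReal.rpow_le_one ?_ (by positivity)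
    refine le_trans (le_of_eq ?_) (hle hp1)
    rw [hq]
    exact lintegral_congr fun ω => by rw [Real.enorm_of_nonneg (hφ ω)]

end Weighted

/-- There is a universal constant `K` (one may take the Grothendieck constant) such
that every bounded bilinear form `u` on `L^s(μ) × L^t(ν)` with `2 ≤ s, t < ∞` and
`|u(x,y)| ≤ M ‖x‖ ‖y‖` admits weights `φ, ψ ≥ 0` with `‖φ‖_{L^{(s/2)'}(μ)} ≤ 1`,
`‖ψ‖_{L^{(t/2)'}(ν)} ≤ 1` (the conjugate exponents being specified by
`1/(s/2) + 1/s' = 1` in `ℝ≥0∞`) such that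
`|u(x,y)| ≤ K M (∫ x² φ dμ)^{1/2} (∫ y² ψ dν)^{1/2}` for all `x, y`. -/
theorem grothendieck_krivine_weighted :
    ∃ K : ℝ, ∀ (Ω₁ : Type u) (Ω₂ : Type v)
      [MeasurableSpace Ω₁] [MeasurableSpace Ω₂]
      (μ : Measure Ω₁) (ν : Measure Ω₂) [SigmaFinite μ] [SigmaFinite ν]
      (s t : ℝ), 2 ≤ s → 2 ≤ t →
      ∀ (u : Lp ℝ (ENNReal.ofReal s) μ →ₗ[ℝ] Lp ℝ (ENNReal.ofReal t) ν →ₗ[ℝ] ℝ)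
        (M : ℝ), (∀ x y, |u x y| ≤ M * ‖x‖ * ‖y‖) →
      ∃ (φ : Ω₁ → ℝ) (ψ : Ω₂ → ℝ) (s' t' : ℝ≥0∞),
        Measurable φ ∧ Measurable ψ ∧
        (∀ ω, 0 ≤ φ ω) ∧ (∀ ω, 0 ≤ ψ ω) ∧
        1 / ENNReal.ofReal (s / 2) + 1 / s' = 1 ∧
        1 / ENNReal.ofReal (t / 2) + 1 / t' = 1 ∧
        eLpNorm φ s' μ ≤ 1 ∧ eLpNorm ψ t' ν ≤ 1 ∧
        ∀ (x : Lp ℝ (ENNReal.ofReal s) μ) (y : Lp ℝ (ENNReal.ofReal t) ν),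
          ENNReal.ofReal |u x y| ≤
            ENNReal.ofReal (K * M) *
              (∫⁻ ω, ENNReal.ofReal (x ω ^ 2 * φ ω) ∂μ) ^ ((1 : ℝ) / 2) *
              (∫⁻ ω, ENNReal.ofReal (y ω ^ 2 * ψ ω) ∂ν) ^ ((1 : ℝ) / 2) := by
  refine ⟨392, fun Ω₁ Ω₂ _ _ μ ν _ _ s t hs ht u M hu => ?_⟩
  have : Fact (1 ≤ ENNReal.ofReal s) := ⟨by rw [ENNReal.one_le_ofReal]; linarith⟩
  have : Fact (1 ≤ ENNReal.ofReal t) := ⟨by rw [ENNReal.one_le_ofReal]; linarith⟩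
  obtain ⟨N₁, T₁, s', ⟨hm₁, hc₁, ha₁, h0₁⟩, hT₁, hs', hd₁⟩ := exists_simpleFunc_embedding μ hs
  obtain ⟨N₂, T₂, t', ⟨hm₂, hc₂, ha₂, h0₂⟩, hT₂, ht', hd₂⟩ := exists_simpleFunc_embedding ν ht
  have hu0 : M ≤ 0 → ∀ x y, u x y = 0 := fun hM x y => by
    have : M * ‖x‖ * ‖y‖ ≤ 0 :=
      mul_nonpos_of_nonpos_of_nonneg (mul_nonpos_of_nonpos_of_nonneg hM (norm_nonneg x))
        (norm_nonneg y)
    exact abs_nonpos_iff.1 ((hu x y).trans this)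
  let B : (SimpleFunc Ω₁ ℝ) →ₗ[ℝ] (SimpleFunc Ω₂ ℝ) →ₗ[ℝ] ℝ := M⁻¹ • u.compl₁₂ T₁ T₂
  have hBu : ∀ f g, B f g = M⁻¹ * u (T₁ f) (T₂ g) := fun f g => rfl
  have hB : ∀ f g, |B f g| ≤ √(N₁ (f ^ 2)) * √(N₂ (g ^ 2)) := by
    intro f g
    rw [hBu, ← hT₁, ← hT₂]
    rcases le_or_gt M 0 with hM | hM
    · rw [hu0 hM, mul_zero, abs_zero]
      positivity
    · rw [abs_mul, abs_of_pos (inv_pos.2 hM), inv_mul_le_iff₀ hM, ← mul_assoc]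
      exact hu _ _
  obtain ⟨l₁, l₂, hl₁, hl₂, hl⟩ := SimpleFunc.exists_linear_dominating B N₁ N₂ hm₁ hm₂ hc₁ hc₂
    ha₁ ha₂ h0₁ h0₂ hB
  obtain ⟨φ, hφm, hφ, hφn, hφa⟩ := hd₁ l₁ hl₁
  obtain ⟨ψ, hψm, hψ, hψn, hψa⟩ := hd₂ l₂ hl₂
  refine ⟨φ, ψ, s', t', hφm, hψm, hφ, hψ, hs', ht', hφn, hψn, fun x y => ?_⟩
  rcases le_or_gt M 0 with hM | hM
  · simp [hu0 hM]
  obtain ⟨f, hf, hfle⟩ := hφa x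
  obtain ⟨g, hg, hgle⟩ := hψa y
  have hcont : Filter.Tendsto (fun n => u (T₁ (f n)) (T₂ (g n))) Filter.atTop (nhds (u x y)) :=
    ((u.mkContinuous₂ M hu).continuous₂.tendsto (x, y)).comp (hf.prodMk_nhds hg)
  refine le_of_tendsto ((ENNReal.continuous_ofReal.comp continuous_abs).tendsto _ |>.comp hcont)
    (Filter.Eventually.of_forall fun n => ?_)
  have hsqrt : ∀ {a : ℝ} {c : ℝ≥0∞}, ENNReal.ofReal a ≤ 4 * c →
      ENNReal.ofReal (√a) ≤ 2 * c ^ ((1 : ℝ) / 2) := by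
    intro a c h
    have h4 : (4 : ℝ≥0∞) ^ ((1 : ℝ) / 2) = 2 := by
      rw [show (4 : ℝ≥0∞) = 2 ^ (2 : ℝ) by norm_num, ← ENNReal.rpow_mul]
      norm_num
    rcases le_total a 0 with ha | ha
    · simp [Real.sqrt_eq_zero_of_nonpos ha]
    · rw [Real.sqrt_eq_rpow, ← ENNReal.ofReal_rpow_of_nonneg ha (by norm_num), ← h4,
        ← ENNReal.mul_rpow_of_nonneg _ _ (by norm_num)]
      exact ENNReal.rpow_le_rpow h (by norm_num)
  have hn : |u (T₁ (f n)) (T₂ (g n))| ≤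
      M * 98 * (√(l₁ (f n ^ 2)) * √(l₂ (g n ^ 2))) := by
    have := hl (f n) (g n)
    rwa [hBu, abs_mul, abs_of_pos (inv_pos.2 hM), inv_mul_le_iff₀ hM, ← mul_assoc] at this
  calc ENNReal.ofReal |u (T₁ (f n)) (T₂ (g n))|
      ≤ ENNReal.ofReal (M * 98 * (√(l₁ (f n ^ 2)) * √(l₂ (g n ^ 2)))) :=
        ENNReal.ofReal_le_ofReal hn
    _ = ENNReal.ofReal (M * 98) * (ENNReal.ofReal (√(l₁ (f n ^ 2))) *
          ENNReal.ofReal (√(l₂ (g n ^ 2)))) := by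
        rw [ENNReal.ofReal_mul (p := M * 98) (by positivity),
          ENNReal.ofReal_mul (Real.sqrt_nonneg _)]
    _ ≤ ENNReal.ofReal (M * 98) *
          ((2 * (∫⁻ ω, ENNReal.ofReal (x ω ^ 2 * φ ω) ∂μ) ^ ((1 : ℝ) / 2)) *
          (2 * (∫⁻ ω, ENNReal.ofReal (y ω ^ 2 * ψ ω) ∂ν) ^ ((1 : ℝ) / 2))) := by
        gcongr
        · exact hsqrt (hfle n)
        · exact hsqrt (hgle n)
    _ = _ := by
        rw [show (392 : ℝ) * M = M * 98 * (2 * 2) by ring,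
          ENNReal.ofReal_mul (p := M * 98) (by positivity),
          ENNReal.ofReal_mul (p := 2) two_pos.le, ENNReal.ofReal_ofNat]
        ring
end
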